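/- arXiv:math/0607191 — 4 statements merged into one kernel-verified Lean document; each statement's English description precedes it below -/
import Mathlib

section
/- (Subabundance Theorem.) Fix k ≥ 1 and natural numbers n₂, …, n_k. Suppose n₁ = n₁' + n₁'' + 1, s = s' + s'', and a_j = a_j' + a_j'' for j = 2, …, k. If the statement T(n₁', n₂, …, n_k; s'; a₁ + s'', a₂', …, a_k') holds and is subabundant, and the statement T(n₁'', n₂, …, n_k; s''; a₁ + s', a₂'', …, a_k'') holds and is subabundant, then the statement T(n₁, n₂, …, n_k; s; a₁, a₂, …, a_k) holds and is subabundant. -/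
open scoped TensorProduct

/-- The subspace `G^i_p = v₁ ⊗ ⋯ ⊗ v_{i-1} ⊗ Vᵢ ⊗ v_{i+1} ⊗ ⋯ ⊗ v_k` of the tensor
space `⨂ᵢ K^{nᵢ+1}` attached to the point `p = v₁ ⊗ ⋯ ⊗ v_k`. -/
noncomputable def segreG (K : Type*) [Field K] {k : ℕ} (n : Fin k → ℕ)
    (v : ∀ i, Fin (n i + 1) → K) (i : Fin k) :
    Submodule K (⨂[K] i, (Fin (n i + 1) → K)) :=
  LinearMap.range ((PiTensorProduct.tprod K).toLinearMap v i)

/-- The affine tangent space `T_p = Σᵢ v₁ ⊗ ⋯ ⊗ Vᵢ ⊗ ⋯ ⊗ v_k` to the Segre variety at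
`p = v₁ ⊗ ⋯ ⊗ v_k`. -/
noncomputable def segreTangent (K : Type*) [Field K] {k : ℕ} (n : Fin k → ℕ)
    (v : ∀ i, Fin (n i + 1) → K) : Submodule K (⨂[K] i, (Fin (n i + 1) → K)) :=
  ⨆ i, segreG K n v i

/-- The statement `T(n₁,…,n_k; s; a₁,…,a_k)` of Abo–Ottaviani–Peterson holds:
there are points `p₁,…,p_s` and `q_{i,1},…,q_{i,aᵢ}` (pure tensors of nonzero vectors)
such that the span of the tangent spaces `T_{p_j}` together with the subspaces
`G^i_{q_{i,l}}` has the expected (maximal possible) dimension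
`min (s(1 + Σ nᵢ) + Σ aᵢ(nᵢ+1)) (Π (nᵢ+1))`. -/
def THolds (K : Type*) [Field K] {k : ℕ} (n : Fin k → ℕ) (s : ℕ) (a : Fin k → ℕ) : Prop :=
  ∃ (p : Fin s → ∀ i, Fin (n i + 1) → K)
    (q : ∀ i : Fin k, Fin (a i) → ∀ j, Fin (n j + 1) → K),
    (∀ j i, p j i ≠ 0) ∧ (∀ i l j, q i l j ≠ 0) ∧
    Module.finrank K
      (((⨆ j, segreTangent K n (p j)) ⊔ (⨆ i, ⨆ l, segreG K n (q i l) i))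
        : Submodule K (⨂[K] i, (Fin (n i + 1) → K)))
      = min (s * (1 + ∑ i, n i) + ∑ i, a i * (n i + 1)) (∏ i, (n i + 1))

/-- The statement `T(n₁,…,n_k; s; a₁,…,a_k)` fails: every choice of points gives a span
of dimension strictly smaller than the expected dimension. -/
def TFails (K : Type*) [Field K] {k : ℕ} (n : Fin k → ℕ) (s : ℕ) (a : Fin k → ℕ) : Prop :=
  ∀ (p : Fin s → ∀ i, Fin (n i + 1) → K)
    (q : ∀ i : Fin k, Fin (a i) → ∀ j, Fin (n j + 1) → K),
    (∀ j i, p j i ≠ 0) → (∀ i l j, q i l j ≠ 0) →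
    Module.finrank K
      (((⨆ j, segreTangent K n (p j)) ⊔ (⨆ i, ⨆ l, segreG K n (q i l) i))
        : Submodule K (⨂[K] i, (Fin (n i + 1) → K)))
      < min (s * (1 + ∑ i, n i) + ∑ i, a i * (n i + 1)) (∏ i, (n i + 1))

/-- The tuple `(n; s; a)` is subabundant. -/
def Subabundant {k : ℕ} (n : Fin k → ℕ) (s : ℕ) (a : Fin k → ℕ) : Prop :=
  s * (1 + ∑ i, n i) + ∑ i, a i * (n i + 1) ≤ ∏ i, (n i + 1)

/-- The tuple `(n; s; a)` is superabundant. -/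
def Superabundant {k : ℕ} (n : Fin k → ℕ) (s : ℕ) (a : Fin k → ℕ) : Prop :=
  ∏ i, (n i + 1) ≤ s * (1 + ∑ i, n i) + ∑ i, a i * (n i + 1)

section SegreSpan

open Filter Module

variable {K : Type*} [Field K] {ι : Type*} [DecidableEq ι]
  {V : ι → Type*} [∀ i, AddCommGroup (V i)] [∀ i, Module K (V i)]

/-- The span `Σ_l v₁ ⊗ ⋯ ⊗ V_{d l} ⊗ ⋯ ⊗ v_k` of the subspaces `G^{d l}_{q l}`. -/
noncomputable def gSpan (K : Type*) [Field K] {ι : Type*} [DecidableEq ι]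
    {V : ι → Type*} [∀ i, AddCommGroup (V i)] [∀ i, Module K (V i)]
    {τ : Type*} (d : τ → ι) (q : τ → ∀ i, V i) : Submodule K (⨂[K] i, V i) :=
  ⨆ l, LinearMap.range ((PiTensorProduct.tprod K).toLinearMap (q l) (d l))

theorem eventually_add_smul_ne_zero {M : Type*} [AddCommGroup M] [Module K M] {u w : M} {t₀ : K}
    (h : u + t₀ • w ≠ 0) : ∀ᶠ t : K in cofinite, u + t • w ≠ 0 := by
  rw [eventually_cofinite]
  refine Set.Subsingleton.finite fun x hx y hy => ?_
  simp only [ne_eq, not_not, Set.mem_ofPred_eq] at hx hy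
  by_contra hxy
  have hw : (x - y) • w = 0 := by
    rw [sub_smul, ← add_sub_add_left_eq_sub _ _ u, hx, hy, sub_zero]
  have hw0 : w = 0 := (smul_eq_zero.mp hw).resolve_left (sub_ne_zero.mpr hxy)
  subst hw0
  simp_all

/-- Linear independence is an open condition along a polynomial curve. -/
theorem eventually_linearIndependent_of_polynomial {M κ : Type*} [AddCommGroup M] [Module K M]
    [Fintype κ] [DecidableEq κ] (v : κ → K → M)
    (hv : ∀ c (φ : M →ₗ[K] K), ∃ P : Polynomial K, ∀ t, φ (v c t) = P.eval t) {t₀ : K}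
    (h : LinearIndependent K fun c => v c t₀) :
    ∀ᶠ t in cofinite, LinearIndependent K fun c => v c t := by
  obtain ⟨g, hg⟩ := (Fintype.linearCombination K fun c => v c t₀).exists_leftInverse_of_injective
    (LinearMap.ker_eq_bot.mpr (h.fintypeLinearCombination_injective))
  choose P hP using fun c c' => hv c ((LinearMap.proj c').comp g)
  have hdet : ∀ t, (Matrix.det (Matrix.of P)).eval t
      = (Matrix.of fun c c' => g (v c t) c').det := by
    intro t
    rw [← Polynomial.coe_evalRingHom, RingHom.map_det]
    congr 1
    ext c c'
    simpa using (hP c c' t).symm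
  have hgv : ∀ c, g (v c t₀) = Pi.single c 1 := by
    intro c
    have := LinearMap.congr_fun hg (Pi.single c 1)
    simpa [Fintype.linearCombination_apply_single] using this
  have hne : Matrix.det (Matrix.of P) ≠ 0 := by
    intro h0
    have h1 := hdet t₀
    have h2 : (Matrix.of fun c c' => g (v c t₀) c') = 1 := by
      ext c c'
      simp [hgv, Matrix.one_apply, Pi.single_apply, eq_comm]
    rw [h0, h2] at h1
    simp at h1
  rw [eventually_cofinite]
  refine (Polynomial.finite_setOfPred_isRoot hne).subset fun t ht => ?_
  by_contra hroot
  apply ht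
  have hu : IsUnit (Matrix.of fun c c' => g (v c t) c') := by
    rw [Matrix.isUnit_iff_isUnit_det, isUnit_iff_ne_zero, ← hdet]
    exact hroot
  have hrows : LinearIndependent K fun c => g (v c t) :=
    Matrix.linearIndependent_rows_of_isUnit hu
  exact LinearIndependent.of_comp g hrows

theorem exists_polynomial_eval_eq_multilinearMap_add_smul [Fintype ι] (f : MultilinearMap K V K)
    (A B : ∀ i, V i) : ∃ P : Polynomial K, ∀ t : K, f (A + t • B) = P.eval t := by
  refine ⟨∑ s : Finset ι, Polynomial.C (f (s.piecewise B A)) * Polynomial.X ^ s.card, fun t => ?_⟩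
  rw [add_comm, MultilinearMap.map_add_univ, Polynomial.eval_finsetSum]
  refine Finset.sum_congr rfl fun s _ => ?_
  have : s.piecewise (t • B) A = s.piecewise (fun i => t • s.piecewise B A i) (s.piecewise B A) := by
    ext i
    by_cases hi : i ∈ s <;> simp [hi]
  rw [this, MultilinearMap.map_piecewise_smul, Finset.prod_const, smul_eq_mul, mul_comm,
    Polynomial.eval_mul, Polynomial.eval_C, Polynomial.eval_pow, Polynomial.eval_X]

theorem gSpan_eq_span {τ : Type*} (d : τ → ι) (q : τ → ∀ i, V i) :
    gSpan K d q = Submodule.span K (Set.range fun c : Σ l, V (d l) =>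
      PiTensorProduct.tprod K (Function.update (q c.1) (d c.1) c.2)) := by
  apply le_antisymm
  · refine iSup_le fun l => ?_
    rintro _ ⟨w, rfl⟩
    exact Submodule.subset_span ⟨⟨l, w⟩, rfl⟩
  · rw [Submodule.span_le]
    rintro _ ⟨⟨l, w⟩, rfl⟩
    exact Submodule.mem_iSup_of_mem l ⟨w, rfl⟩

/-- The dimension of `gSpan` is lower semicontinuous along lines. -/
theorem eventually_finrank_le_finrank_gSpan [Fintype ι] [∀ i, FiniteDimensional K (V i)]
    {τ : Type*} (d : τ → ι) (A B : τ → ∀ i, V i) (t₀ : K) :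
    ∀ᶠ t : K in cofinite, finrank K (gSpan K d fun l => A l + t₀ • B l)
      ≤ finrank K (gSpan K d fun l => A l + t • B l) := by
  classical
  obtain ⟨κ, a, -, hspan, hli⟩ := exists_linearIndependent' K (fun c : Σ l, V (d l) =>
    PiTensorProduct.tprod K (Function.update (A c.1 + t₀ • B c.1) (d c.1) c.2))
  have : Finite κ := hli.finite
  have : Fintype κ := Fintype.ofFinite κ
  have hcard : finrank K (gSpan K d fun l => A l + t₀ • B l) = Fintype.card κ := by
    rw [gSpan_eq_span, ← hspan, finrank_span_eq_card hli]
  have hev := eventually_linearIndependent_of_polynomial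
    (fun (c : κ) t => PiTensorProduct.tprod K
      (Function.update (A (a c).1 + t • B (a c).1) (d (a c).1) (a c).2)) ?_ hli
  · filter_upwards [hev] with t ht
    rw [hcard, gSpan_eq_span, ← finrank_span_eq_card ht]
    refine Submodule.finrank_mono (Submodule.span_mono ?_)
    rintro _ ⟨c, rfl⟩
    exact ⟨a c, rfl⟩
  · intro c φ
    obtain ⟨P, hP⟩ := exists_polynomial_eval_eq_multilinearMap_add_smul
      (φ.compMultilinearMap (PiTensorProduct.tprod K))
      (Function.update (A (a c).1) (d (a c).1) (a c).2)
      (Function.update (B (a c).1) (d (a c).1) 0)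
    refine ⟨P, fun t => ?_⟩
    rw [← hP t]
    simp only [LinearMap.compMultilinearMap_apply]
    congr 2
    ext i
    by_cases hi : i = d (a c).1
    · subst hi; simp
    · simp [hi]

theorem range_toLinearMap_congr {v w : ∀ i, V i} {i : ι} (h : ∀ j, j ≠ i → v j = w j) :
    LinearMap.range ((PiTensorProduct.tprod K).toLinearMap v i)
      = LinearMap.range ((PiTensorProduct.tprod K).toLinearMap w i) := by
  have : (PiTensorProduct.tprod K).toLinearMap v i
      = (PiTensorProduct.tprod K).toLinearMap w i := by
    ext x
    simp only [MultilinearMap.toLinearMap_apply]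
    congr 1
    ext j
    by_cases hj : j = i
    · subst hj; simp
    · simp [hj, h j hj]
  rw [this]

theorem gSpan_congr {τ : Type*} {d : τ → ι} {q q' : τ → ∀ i, V i}
    (h : ∀ l i, i ≠ d l → q l i = q' l i) : gSpan K d q = gSpan K d q' :=
  iSup_congr fun l => range_toLinearMap_congr (h l)

theorem map_gSpan_le {W : ι → Type*} [∀ i, AddCommGroup (W i)] [∀ i, Module K (W i)]
    (f : ∀ i, V i →ₗ[K] W i) {τ : Type*} (d : τ → ι) (q : τ → ∀ i, V i) :
    (gSpan K d q).map (PiTensorProduct.map f) ≤ gSpan K d fun l i => f i (q l i) := by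
  rw [gSpan, Submodule.map_iSup]
  refine iSup_mono fun l => ?_
  rintro _ ⟨_, ⟨w, rfl⟩, rfl⟩
  refine ⟨f _ w, ?_⟩
  simp only [MultilinearMap.toLinearMap_apply, PiTensorProduct.map_tprod]
  congr 1
  ext j
  by_cases hj : j = d l
  · subst hj; simp
  · simp [hj]

theorem piTensorProduct_map_eq_zero {κ : Type*} {A B : κ → Type*} [∀ i, AddCommGroup (A i)]
    [∀ i, Module K (A i)] [∀ i, AddCommGroup (B i)] [∀ i, Module K (B i)]
    (f : ∀ i, A i →ₗ[K] B i) {i : κ} (hi : f i = 0) : PiTensorProduct.map f = 0 := by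
  ext v
  simp only [LinearMap.compMultilinearMap_apply, PiTensorProduct.map_tprod, LinearMap.zero_apply]
  exact MultilinearMap.map_coord_zero _ i (by simp [hi])

theorem finrank_add_le_of_map_le {M M' M'' : Type*} [AddCommGroup M] [Module K M]
    [AddCommGroup M'] [Module K M'] [AddCommGroup M''] [Module K M'']
    [FiniteDimensional K M] {F' : M' →ₗ[K] M} {F'' : M'' →ₗ[K] M} {R' : M →ₗ[K] M'}
    {R'' : M →ₗ[K] M''} (h' : R' ∘ₗ F' = LinearMap.id) (h'' : R'' ∘ₗ F'' = LinearMap.id)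
    (h0 : R' ∘ₗ F'' = 0) {U' : Submodule K M'} {U'' : Submodule K M''} {S : Submodule K M}
    (hU' : U'.map F' ≤ S) (hU'' : U''.map F'' ≤ S) :
    finrank K U' + finrank K U'' ≤ finrank K S := by
  have i' : Function.Injective F' := Function.LeftInverse.injective (LinearMap.congr_fun h')
  have i'' : Function.Injective F'' := Function.LeftInverse.injective (LinearMap.congr_fun h'')
  have hdisj : U'.map F' ⊓ U''.map F'' = ⊥ := by
    rw [eq_bot_iff]
    rintro _ ⟨⟨x, _, rfl⟩, ⟨y, _, hy⟩⟩
    have hx : R' (F' x) = x := LinearMap.congr_fun h' x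
    have hy0 : R' (F'' y) = 0 := LinearMap.congr_fun h0 y
    rw [hy, hx] at hy0
    simp [hy0]
  have hsum := Submodule.finrank_sup_add_finrank_inf_eq (U'.map F') (U''.map F'')
  rw [hdisj, finrank_bot, add_zero, ← (Submodule.equivMapOfInjective F' i' U').finrank_eq,
    ← (Submodule.equivMapOfInjective F'' i'' U'').finrank_eq] at hsum
  rw [← hsum]
  exact Submodule.finrank_mono (sup_le hU' hU'')

theorem finrank_iSup_le_sum {M κ : Type*} [AddCommGroup M] [Module K M] [FiniteDimensional K M]
    [Fintype κ] (S : κ → Submodule K M) :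
    finrank K (⨆ c, S c : Submodule K M) ≤ ∑ c, finrank K (S c) := by
  classical
  rw [← Finset.sup_univ_eq_iSup]
  induction (Finset.univ : Finset κ) using Finset.induction_on with
  | empty => simp
  | insert c s hc ih =>
    rw [Finset.sup_insert, Finset.sum_insert hc]
    exact (Submodule.finrank_add_le_finrank_add_finrank _ _).trans (by gcongr)

theorem finrank_iSup_range_toLinearMap_le [Fintype ι] [∀ i, FiniteDimensional K (V i)] (v : ∀ i, V i)
    (hv : ∀ i, v i ≠ 0) :
    finrank K (⨆ i, LinearMap.range ((PiTensorProduct.tprod K).toLinearMap v i) :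
      Submodule K (⨂[K] i, V i)) ≤ 1 + ∑ i, (finrank K (V i) - 1) := by
  choose H hH using fun i => (Submodule.span K {v i}).exists_isCompl
  have hle : (⨆ i, LinearMap.range ((PiTensorProduct.tprod K).toLinearMap v i))
      ≤ Submodule.span K {PiTensorProduct.tprod K v}
        ⊔ ⨆ i, (H i).map ((PiTensorProduct.tprod K).toLinearMap v i) := by
    refine iSup_le fun i => ?_
    rw [LinearMap.range_eq_map, ← (hH i).sup_eq_top, Submodule.map_sup]
    refine sup_le_sup ?_ (le_iSup (fun i => (H i).map
      ((PiTensorProduct.tprod K).toLinearMap v i)) i)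
    rw [Submodule.map_span_le]
    rintro _ rfl
    rw [MultilinearMap.toLinearMap_apply, Function.update_eq_self]
    exact Submodule.mem_span_singleton_self _
  refine (Submodule.finrank_mono hle).trans
    ((Submodule.finrank_add_le_finrank_add_finrank _ _).trans (add_le_add ?_ ?_))
  · exact (finrank_span_le_card _).trans (by simp)
  · refine (finrank_iSup_le_sum _).trans (Finset.sum_le_sum fun i _ => ?_)
    have h := Submodule.finrank_add_eq_of_isCompl (hH i)
    rw [finrank_span_singleton (hv i)] at h
    have := Submodule.finrank_map_le ((PiTensorProduct.tprod K).toLinearMap v i) (H i)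
    omega

theorem gSpan_le_gSpan {τ ρ : Type*} {d : τ → ι} {q : τ → ∀ i, V i} {e : ρ → ι}
    {r : ρ → ∀ i, V i} (h : ∀ l, ∃ m, e m = d l ∧ ∀ i, i ≠ d l → q l i = r m i) :
    gSpan K d q ≤ gSpan K e r := by
  refine iSup_le fun l => ?_
  obtain ⟨m, hm, hq⟩ := h l
  rw [range_toLinearMap_congr hq, ← hm]
  exact le_iSup (fun m => LinearMap.range ((PiTensorProduct.tprod K).toLinearMap (r m) (e m))) m

/-- Specializing the first factor to the two summands of a splitting `V i₀ = V' i₀ ⊕ V'' i₀`: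
the spans in the two smaller tensor spaces are realized simultaneously by one choice of points. The points are found on curves running
from the first configuration (at time `0`) to the second one (at time `1`). -/
theorem exists_finrank_gSpan_add_le [Infinite K] [Fintype ι] [∀ i, FiniteDimensional K (V i)]
    {V' V'' : ι → Type*} [∀ i, AddCommGroup (V' i)] [∀ i, Module K (V' i)]
    [∀ i, FiniteDimensional K (V' i)] [∀ i, AddCommGroup (V'' i)] [∀ i, Module K (V'' i)]
    [∀ i, FiniteDimensional K (V'' i)] {i₀ : ι}
    {f' : ∀ i, V' i →ₗ[K] V i} {r' : ∀ i, V i →ₗ[K] V' i}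
    {f'' : ∀ i, V'' i →ₗ[K] V i} {r'' : ∀ i, V i →ₗ[K] V'' i}
    (hf' : ∀ i, r' i ∘ₗ f' i = LinearMap.id) (hf'' : ∀ i, r'' i ∘ₗ f'' i = LinearMap.id)
    (hr' : ∀ i, i ≠ i₀ → f' i ∘ₗ r' i = LinearMap.id)
    (hr'' : ∀ i, i ≠ i₀ → f'' i ∘ₗ r'' i = LinearMap.id) (h0 : r' i₀ ∘ₗ f'' i₀ = 0)
    {σ' σ'' X τ' τ'' : Type*} [Finite σ'] [Finite σ''] [Finite X]
    (p' : σ' → ∀ i, V' i) (x' : X → ∀ i, V' i) (y' : σ'' → ∀ i, V' i)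
    (d' : τ' → ι) (q' : τ' → ∀ i, V' i)
    (p'' : σ'' → ∀ i, V'' i) (x'' : X → ∀ i, V'' i) (y'' : σ' → ∀ i, V'' i)
    (d'' : τ'' → ι) (q'' : τ'' → ∀ i, V'' i)
    (hp' : ∀ j i, p' j i ≠ 0) (hx' : ∀ j i, x' j i ≠ 0) (hp'' : ∀ j i, p'' j i ≠ 0) :
    ∃ (p : σ' ⊕ σ'' → ∀ i, V i) (x : X → ∀ i, V i),
      (∀ j i, p j i ≠ 0) ∧ (∀ j i, x j i ≠ 0) ∧
      finrank K (gSpan K (Sum.elim Prod.snd (Sum.elim (Sum.elim (fun _ => i₀) fun _ => i₀) d'))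
          (Sum.elim (fun c : σ' × ι => p' c.1) (Sum.elim (Sum.elim x' y') q')))
        + finrank K (gSpan K (Sum.elim Prod.snd (Sum.elim (Sum.elim (fun _ => i₀) fun _ => i₀) d''))
          (Sum.elim (fun c : σ'' × ι => p'' c.1) (Sum.elim (Sum.elim x'' y'') q'')))
        ≤ finrank K (gSpan K (Sum.elim Prod.snd (Sum.elim (fun _ => i₀) (Sum.elim d' d'')))
          (Sum.elim (fun c : (σ' ⊕ σ'') × ι => p c.1) (Sum.elim x
            (Sum.elim (fun l i => f' i (q' l i)) fun l i => f'' i (q'' l i))))) := by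
  have ef' : ∀ i v, r' i (f' i v) = v := fun i => LinearMap.congr_fun (hf' i)
  have ef'' : ∀ i v, r'' i (f'' i v) = v := fun i => LinearMap.congr_fun (hf'' i)
  have er' : ∀ i, i ≠ i₀ → ∀ v, f' i (r' i v) = v := fun i hi => LinearMap.congr_fun (hr' i hi)
  have er'' : ∀ i, i ≠ i₀ → ∀ v, f'' i (r'' i v) = v :=
    fun i hi => LinearMap.congr_fun (hr'' i hi)
  have inj' : ∀ i, Function.Injective (f' i) := fun i => Function.LeftInverse.injective (ef' i)
  have inj'' : ∀ i, Function.Injective (f'' i) := fun i => Function.LeftInverse.injective (ef'' i)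
  let P' : σ' → K → ∀ i, V' i := fun j t i =>
    p' j i + t • (r' i (f'' i (y'' j i)) - p' j i)
  let P'' : σ'' → K → ∀ i, V'' i := fun j t i =>
    r'' i (f' i (y' j i)) + t • (p'' j i - r'' i (f' i (y' j i)))
  let X₀ : X → K → ∀ i, V i := fun j t i =>
    f' i (x' j i) + t • (f'' i (x'' j i) - f' i (x' j i))
  have nP' : ∀ᶠ t in cofinite, ∀ j i, P' j t i ≠ 0 :=
    eventually_all.mpr fun j => eventually_all.mpr fun i =>
      eventually_add_smul_ne_zero (t₀ := 0) (by simpa using hp' j i)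
  have nP'' : ∀ᶠ t in cofinite, ∀ j i, P'' j t i ≠ 0 :=
    eventually_all.mpr fun j => eventually_all.mpr fun i =>
      eventually_add_smul_ne_zero (t₀ := 1) (by simpa using hp'' j i)
  have nX : ∀ᶠ t in cofinite, ∀ j i, X₀ j t i ≠ 0 :=
    eventually_all.mpr fun j => eventually_all.mpr fun i =>
      eventually_add_smul_ne_zero (t₀ := 0)
        (by simpa using (map_ne_zero_iff (f' i) (inj' i)).mpr (hx' j i))
  have e' := eventually_finrank_le_finrank_gSpan (K := K)
    (Sum.elim Prod.snd (Sum.elim (Sum.elim (fun _ : X => i₀) fun _ : σ'' => i₀) d'))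
    (Sum.elim (fun c : σ' × ι => p' c.1) (Sum.elim (Sum.elim x'
      (fun j i => r' i (f'' i (r'' i (f' i (y' j i)))))) q'))
    (Sum.elim (fun (c : σ' × ι) i => r' i (f'' i (y'' c.1 i)) - p' c.1 i) (Sum.elim (Sum.elim
      (fun j i => r' i (f'' i (x'' j i)) - x' j i)
      (fun j i => r' i (f'' i (p'' j i - r'' i (f' i (y' j i)))))) 0)) 0
  have e'' := eventually_finrank_le_finrank_gSpan (K := K)
    (Sum.elim Prod.snd (Sum.elim (Sum.elim (fun _ : X => i₀) fun _ : σ' => i₀) d''))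
    (Sum.elim (fun (c : σ'' × ι) i => r'' i (f' i (y' c.1 i))) (Sum.elim (Sum.elim
      (fun j i => r'' i (f' i (x' j i)))
      (fun j i => r'' i (f' i (p' j i)))) q''))
    (Sum.elim (fun (c : σ'' × ι) i => p'' c.1 i - r'' i (f' i (y' c.1 i))) (Sum.elim (Sum.elim
      (fun j i => x'' j i - r'' i (f' i (x' j i)))
      (fun j i => r'' i (f' i (r' i (f'' i (y'' j i)) - p' j i)))) 0)) 1
  obtain ⟨t, hP', hP'', hX, he', he''⟩ :=
    (nP'.and (nP''.and (nX.and (e'.and e'')))).exists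
  refine ⟨Sum.elim (fun j i => f' i (P' j t i)) (fun j i => f'' i (P'' j t i)),
    fun j => X₀ j t, ?_, hX, ?_⟩
  · rintro (j | j) i
    · exact (map_ne_zero_iff (f' i) (inj' i)).mpr (hP' j i)
    · exact (map_ne_zero_iff (f'' i) (inj'' i)).mpr (hP'' j i)
  refine (add_le_add (le_trans (le_of_eq ?_) he') (le_trans (le_of_eq ?_) he'')).trans
    (finrank_add_le_of_map_le (F' := PiTensorProduct.map f') (F'' := PiTensorProduct.map f'')
      (R' := PiTensorProduct.map r') (R'' := PiTensorProduct.map r'') ?_ ?_ ?_ ?_ ?_)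
  · rw [gSpan_congr]
    rintro ((c | ((j | j) | l))) i hi
    · simp
    · simp
    · simp at hi
      simp [er'' i hi, ef']
    · simp
  · rw [gSpan_congr]
    rintro ((c | ((j | j) | l))) i hi
    · simp
    · simp
    · simp at hi
      simp [er' i hi, ef'']
    · simp
  · rw [← PiTensorProduct.map_comp]
    simp [hf']
  · rw [← PiTensorProduct.map_comp]
    simp [hf'']
  · rw [← PiTensorProduct.map_comp]
    exact piTensorProduct_map_eq_zero _ h0
  · refine (map_gSpan_le f' _ _).trans (gSpan_le_gSpan ?_)
    rintro ((c | ((j | j) | l)))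
    · refine ⟨Sum.inl (Sum.inl c.1, c.2), rfl, fun i _ => ?_⟩
      simp [P']
    · refine ⟨Sum.inr (Sum.inl j), rfl, fun i hi => ?_⟩
      simp only [Sum.elim_inl, Sum.elim_inr] at hi
      simp [X₀, er' i hi]
    · refine ⟨Sum.inl (Sum.inr j, i₀), rfl, fun i hi => ?_⟩
      simp only [Sum.elim_inl, Sum.elim_inr] at hi
      simp [P'', er' i hi]
    · refine ⟨Sum.inr (Sum.inr (Sum.inl l)), rfl, fun i _ => ?_⟩
      simp
  · refine (map_gSpan_le f'' _ _).trans (gSpan_le_gSpan ?_)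
    rintro ((c | ((j | j) | l)))
    · refine ⟨Sum.inl (Sum.inr c.1, c.2), rfl, fun i _ => ?_⟩
      simp [P'']
    · refine ⟨Sum.inr (Sum.inl j), rfl, fun i hi => ?_⟩
      simp only [Sum.elim_inl, Sum.elim_inr] at hi
      simp [X₀, er'' i hi]
    · refine ⟨Sum.inl (Sum.inl j, i₀), rfl, fun i hi => ?_⟩
      simp only [Sum.elim_inl, Sum.elim_inr] at hi
      simp [P', er'' i hi]
    · refine ⟨Sum.inr (Sum.inr (Sum.inr l)), rfl, fun i _ => ?_⟩
      simp

/-- A splitting of the factor `i₀` into two summands, all other factors being unchanged. -/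
theorem exists_splitting {V' V'' : ι → Type*} [∀ i, AddCommGroup (V' i)] [∀ i, Module K (V' i)]
    [∀ i, AddCommGroup (V'' i)] [∀ i, Module K (V'' i)]
    [∀ i, FiniteDimensional K (V i)] [∀ i, FiniteDimensional K (V' i)]
    [∀ i, FiniteDimensional K (V'' i)] {i₀ : ι}
    (h₀ : finrank K (V i₀) = finrank K (V' i₀) + finrank K (V'' i₀))
    (h' : ∀ i, i ≠ i₀ → finrank K (V i) = finrank K (V' i))
    (h'' : ∀ i, i ≠ i₀ → finrank K (V i) = finrank K (V'' i)) :
    ∃ (f' : ∀ i, V' i →ₗ[K] V i) (r' : ∀ i, V i →ₗ[K] V' i)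
      (f'' : ∀ i, V'' i →ₗ[K] V i) (r'' : ∀ i, V i →ₗ[K] V'' i),
      (∀ i, r' i ∘ₗ f' i = LinearMap.id) ∧ (∀ i, r'' i ∘ₗ f'' i = LinearMap.id) ∧
      (∀ i, i ≠ i₀ → f' i ∘ₗ r' i = LinearMap.id) ∧
      (∀ i, i ≠ i₀ → f'' i ∘ₗ r'' i = LinearMap.id) ∧ r' i₀ ∘ₗ f'' i₀ = 0 := by
  have key : ∀ i, ∃ (f' : V' i →ₗ[K] V i) (r' : V i →ₗ[K] V' i)
      (f'' : V'' i →ₗ[K] V i) (r'' : V i →ₗ[K] V'' i),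
      r' ∘ₗ f' = LinearMap.id ∧ r'' ∘ₗ f'' = LinearMap.id ∧
      (i ≠ i₀ → f' ∘ₗ r' = LinearMap.id) ∧
      (i ≠ i₀ → f'' ∘ₗ r'' = LinearMap.id) ∧ (i = i₀ → r' ∘ₗ f'' = 0) := by
    intro i
    by_cases hi : i = i₀
    · subst hi
      let e : V i ≃ₗ[K] V' i × V'' i :=
        LinearEquiv.ofFinrankEq _ _ (by rw [h₀, finrank_prod])
      refine ⟨e.symm.toLinearMap ∘ₗ LinearMap.inl K _ _, LinearMap.fst K _ _ ∘ₗ e.toLinearMap,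
        e.symm.toLinearMap ∘ₗ LinearMap.inr K _ _, LinearMap.snd K _ _ ∘ₗ e.toLinearMap,
        ?_, ?_, fun h => absurd rfl h, fun h => absurd rfl h, fun _ => ?_⟩ <;>
      · ext v
        simp
    · let e' : V' i ≃ₗ[K] V i := LinearEquiv.ofFinrankEq _ _ (h' i hi).symm
      let e'' : V'' i ≃ₗ[K] V i := LinearEquiv.ofFinrankEq _ _ (h'' i hi).symm
      refine ⟨e', e'.symm, e'', e''.symm, ?_, ?_, fun _ => ?_, fun _ => ?_,
        fun h => absurd h hi⟩ <;> simp
  choose f' r' f'' r'' h1 h2 h3 h4 h5 using key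
  exact ⟨f', r', f'', r'', h1, h2, h3, h4, h5 i₀ rfl⟩

end SegreSpan

theorem segre_span_eq_gSpan {K : Type*} [Field K] {k : ℕ} (n : Fin k → ℕ) {s : ℕ} {a : Fin k → ℕ}
    (p : Fin s → ∀ i, Fin (n i + 1) → K) (q : ∀ i : Fin k, Fin (a i) → ∀ j, Fin (n j + 1) → K) :
    (⨆ j, segreTangent K n (p j)) ⊔ (⨆ i, ⨆ l, segreG K n (q i l) i)
      = gSpan K (Sum.elim Prod.snd (Sigma.fst : (Σ i, Fin (a i)) → Fin k))
          (Sum.elim (fun c : Fin s × Fin k => p c.1) fun c => q c.1 c.2) := by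
  simp only [gSpan, iSup_sum, iSup_prod, iSup_sigma, Sum.elim_inl, Sum.elim_inr, segreTangent,
    segreG]
  rfl

theorem finrank_segre_span_le {K : Type*} [Field K] {k : ℕ} (n : Fin k → ℕ) {s : ℕ}
    {a : Fin k → ℕ} (p : Fin s → ∀ i, Fin (n i + 1) → K)
    (q : ∀ i : Fin k, Fin (a i) → ∀ j, Fin (n j + 1) → K) (hp : ∀ j i, p j i ≠ 0) :
    Module.finrank K
      (((⨆ j, segreTangent K n (p j)) ⊔ (⨆ i, ⨆ l, segreG K n (q i l) i))
        : Submodule K (⨂[K] i, (Fin (n i + 1) → K)))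
      ≤ s * (1 + ∑ i, n i) + ∑ i, a i * (n i + 1) := by
  refine (Submodule.finrank_add_le_finrank_add_finrank _ _).trans (add_le_add ?_ ?_)
  · refine (finrank_iSup_le_sum _).trans ?_
    have h : ∀ j ∈ Finset.univ, Module.finrank K (segreTangent K n (p j)) ≤ 1 + ∑ i, n i :=
      fun j _ => (finrank_iSup_range_toLinearMap_le (K := K) (p j) (hp j)).trans_eq (by simp)
    simpa using Finset.sum_le_card_nsmul _ _ _ h
  · refine (finrank_iSup_le_sum _).trans (Finset.sum_le_sum fun i _ => ?_)
    refine (finrank_iSup_le_sum _).trans ?_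
    have h : ∀ l ∈ Finset.univ, Module.finrank K (segreG K n (q i l) i) ≤ n i + 1 :=
      fun l _ => (LinearMap.finrank_range_le
        ((PiTensorProduct.tprod K).toLinearMap (q i l) i)).trans_eq (by simp)
    simpa using Finset.sum_le_card_nsmul _ _ _ h

/-- The parameter counts and the ambient dimensions are additive under a splitting. -/
theorem expected_dim_split {k : ℕ} (i₀ : Fin k) {n n' n'' a a' a'' : Fin k → ℕ} {s' s'' : ℕ}
    (hn₀ : n i₀ = n' i₀ + n'' i₀ + 1) (hn' : ∀ i, i ≠ i₀ → n' i = n i)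
    (hn'' : ∀ i, i ≠ i₀ → n'' i = n i) (ha' : a' i₀ = a i₀ + s'') (ha'' : a'' i₀ = a i₀ + s')
    (ha : ∀ i, i ≠ i₀ → a i = a' i + a'' i) :
    (s' + s'') * (1 + ∑ i, n i) + ∑ i, a i * (n i + 1)
      = (s' * (1 + ∑ i, n' i) + ∑ i, a' i * (n' i + 1))
        + (s'' * (1 + ∑ i, n'' i) + ∑ i, a'' i * (n'' i + 1)) ∧
    ∏ i, (n i + 1) = ∏ i, (n' i + 1) + ∏ i, (n'' i + 1) := by
  have hi : i₀ ∈ Finset.univ := Finset.mem_univ i₀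
  simp only [← Finset.add_sum_erase _ _ hi, ← Finset.mul_prod_erase _ _ hi]
  have hne : ∀ {i}, i ∈ Finset.univ.erase i₀ → i ≠ i₀ := Finset.ne_of_mem_erase
  have e : ∑ i ∈ Finset.univ.erase i₀, a i * (n i + 1)
      = ∑ i ∈ Finset.univ.erase i₀, (a' i * (n i + 1) + a'' i * (n i + 1)) :=
    Finset.sum_congr rfl fun i h => by rw [ha i (hne h), add_mul]
  have e' : ∑ i ∈ Finset.univ.erase i₀, a' i * (n' i + 1)
      = ∑ i ∈ Finset.univ.erase i₀, a' i * (n i + 1) :=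
    Finset.sum_congr rfl fun i h => by rw [hn' i (hne h)]
  have e'' : ∑ i ∈ Finset.univ.erase i₀, a'' i * (n'' i + 1)
      = ∑ i ∈ Finset.univ.erase i₀, a'' i * (n i + 1) :=
    Finset.sum_congr rfl fun i h => by rw [hn'' i (hne h)]
  rw [e, e', e'', Finset.sum_add_distrib, Finset.sum_congr rfl fun i h => hn' i (hne h),
    Finset.sum_congr rfl fun i h => hn'' i (hne h),
    Finset.prod_congr rfl fun i h => congrArg (· + 1) (hn' i (hne h)),
    Finset.prod_congr rfl fun i h => congrArg (· + 1) (hn'' i (hne h)), hn₀, ha', ha'']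
  constructor <;> ring

theorem THolds.of_splitting {K : Type*} [Field K] [Infinite K] {k : ℕ} (i₀ : Fin k)
    {n n' n'' a a' a'' : Fin k → ℕ} {s' s'' : ℕ}
    (hn₀ : n i₀ = n' i₀ + n'' i₀ + 1) (hn' : ∀ i, i ≠ i₀ → n' i = n i)
    (hn'' : ∀ i, i ≠ i₀ → n'' i = n i) (ha' : a' i₀ = a i₀ + s'') (ha'' : a'' i₀ = a i₀ + s')
    (ha : ∀ i, i ≠ i₀ → a i = a' i + a'' i)
    (h' : THolds K n' s' a') (hs' : Subabundant n' s' a')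
    (h'' : THolds K n'' s'' a'') (hs'' : Subabundant n'' s'' a'') :
    THolds K n (s' + s'') a ∧ Subabundant n (s' + s'') a := by
  obtain ⟨hsum, hprod⟩ := expected_dim_split i₀ hn₀ hn' hn'' ha' ha'' ha
  have hsub : Subabundant n (s' + s'') a := by
    unfold Subabundant at *
    omega
  refine ⟨?_, hsub⟩
  obtain ⟨p', q', hp', hq', hd'⟩ := h'
  obtain ⟨p'', q'', hp'', hq'', hd''⟩ := h''
  rw [min_eq_left hs', segre_span_eq_gSpan] at hd'
  rw [min_eq_left hs'', segre_span_eq_gSpan] at hd''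
  obtain ⟨f', r', f'', r'', hf', hf'', hr', hr'', h0⟩ := exists_splitting (K := K) (i₀ := i₀)
    (V := fun i => Fin (n i + 1) → K) (V' := fun i => Fin (n' i + 1) → K)
    (V'' := fun i => Fin (n'' i + 1) → K) (by simp [hn₀]; ring)
    (fun i hi => by simp [hn' i hi]) (fun i hi => by simp [hn'' i hi])
  have inj' : ∀ i, Function.Injective (f' i) := fun i =>
    Function.LeftInverse.injective (LinearMap.congr_fun (hf' i))
  have inj'' : ∀ i, Function.Injective (f'' i) := fun i =>
    Function.LeftInverse.injective (LinearMap.congr_fun (hf'' i))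
  obtain ⟨p, x, hp, hx, hdim⟩ := exists_finrank_gSpan_add_le hf' hf'' hr' hr'' h0
    p' (fun l => q' i₀ (Fin.cast ha'.symm (Fin.castAdd s'' l)))
    (fun l => q' i₀ (Fin.cast ha'.symm (Fin.natAdd (a i₀) l)))
    (fun c : Σ i : {i // i ≠ i₀}, Fin (a' i) => c.1.1) (fun c => q' c.1 c.2)
    p'' (fun l => q'' i₀ (Fin.cast ha''.symm (Fin.castAdd s' l)))
    (fun l => q'' i₀ (Fin.cast ha''.symm (Fin.natAdd (a i₀) l)))
    (fun c : Σ i : {i // i ≠ i₀}, Fin (a'' i) => c.1.1) (fun c => q'' c.1 c.2)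
    hp' (fun _ => hq' _ _) hp''
  have hQ : ∀ i, ∃ Q : Fin (a i) → ∀ j, Fin (n j + 1) → K, (∀ l j, Q l j ≠ 0) ∧
      (i = i₀ → ∀ l, ∃ m, Q m = x l) ∧
      (i ≠ i₀ → (∀ l, ∃ m, Q m = fun j => f' j (q' i l j)) ∧
        ∀ l, ∃ m, Q m = fun j => f'' j (q'' i l j)) := by
    intro i
    by_cases hi : i = i₀
    · subst hi
      exact ⟨x, hx, fun _ l => ⟨l, rfl⟩, fun h => absurd rfl h⟩
    · let Q : Fin (a' i) ⊕ Fin (a'' i) → ∀ j, Fin (n j + 1) → K :=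
        Sum.elim (fun l j => f' j (q' i l j)) (fun l j => f'' j (q'' i l j))
      have hQ : ∀ l j, Q l j ≠ 0 := by
        rintro (l | l) j
        · exact (map_ne_zero_iff (f' j) (inj' j)).mpr (hq' i l j)
        · exact (map_ne_zero_iff (f'' j) (inj'' j)).mpr (hq'' i l j)
      refine ⟨fun m => Q (finSumFinEquiv.symm (Fin.cast (ha i hi) m)), fun _ => hQ _,
        fun h => absurd h hi, fun _ => ⟨fun l => ?_, fun l => ?_⟩⟩
      · exact ⟨Fin.cast (ha i hi).symm (finSumFinEquiv (Sum.inl l)), by simp [Q]⟩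
      · exact ⟨Fin.cast (ha i hi).symm (finSumFinEquiv (Sum.inr l)), by simp [Q]⟩
  choose Q hQ0 hQx hQq using hQ
  refine ⟨fun j => p (finSumFinEquiv.symm j), Q, fun _ => hp _, hQ0, ?_⟩
  rw [min_eq_left hsub]
  refine le_antisymm (finrank_segre_span_le n _ Q fun _ => hp _) ?_
  rw [hsum, ← hd', ← hd'', segre_span_eq_gSpan]
  refine le_trans (add_le_add (Submodule.finrank_mono (gSpan_le_gSpan ?_))
    (Submodule.finrank_mono (gSpan_le_gSpan ?_)))
    (hdim.trans (Submodule.finrank_mono (gSpan_le_gSpan ?_)))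
  · rintro (c | ⟨i, l⟩)
    · exact ⟨Sum.inl c, rfl, fun _ _ => rfl⟩
    · by_cases hi : i = i₀
      · subst hi
        obtain ⟨l, rfl⟩ := (finCongr ha'.symm).surjective l
        induction l using Fin.addCases with
        | left l => exact ⟨Sum.inr (Sum.inl (Sum.inl l)), rfl, fun _ _ => rfl⟩
        | right l => exact ⟨Sum.inr (Sum.inl (Sum.inr l)), rfl, fun _ _ => rfl⟩
      · exact ⟨Sum.inr (Sum.inr ⟨⟨i, hi⟩, l⟩), rfl, fun _ _ => rfl⟩
  · rintro (c | ⟨i, l⟩)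
    · exact ⟨Sum.inl c, rfl, fun _ _ => rfl⟩
    · by_cases hi : i = i₀
      · subst hi
        obtain ⟨l, rfl⟩ := (finCongr ha''.symm).surjective l
        induction l using Fin.addCases with
        | left l => exact ⟨Sum.inr (Sum.inl (Sum.inl l)), rfl, fun _ _ => rfl⟩
        | right l => exact ⟨Sum.inr (Sum.inl (Sum.inr l)), rfl, fun _ _ => rfl⟩
      · exact ⟨Sum.inr (Sum.inr ⟨⟨i, hi⟩, l⟩), rfl, fun _ _ => rfl⟩
  · rintro (⟨j, i⟩ | l | ⟨i, l⟩ | ⟨i, l⟩)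
    · exact ⟨Sum.inl (finSumFinEquiv j, i), rfl, fun _ _ => by simp⟩
    · obtain ⟨m, hm⟩ := hQx i₀ rfl l
      exact ⟨Sum.inr ⟨i₀, m⟩, rfl, fun _ _ => by simp [hm]⟩
    · obtain ⟨m, hm⟩ := (hQq i i.2).1 l
      exact ⟨Sum.inr ⟨i, m⟩, rfl, fun _ _ => by simp [hm]⟩
    · obtain ⟨m, hm⟩ := (hQq i i.2).2 l
      exact ⟨Sum.inr ⟨i, m⟩, rfl, fun _ _ => by simp [hm]⟩

/-- Subabundance Theorem.  Suppose `n 0 = n₁' + n₁'' + 1`,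
`s = s' + s''`, `a j = a' j + a'' j` for `j ≠ 0`, `a' 0 = a 0 + s''` and
`a'' 0 = a 0 + s'`.  If `T(n₁', n₂, …; s'; a 0 + s'', a₂', …)` holds and is subabundant
and `T(n₁'', n₂, …; s''; a 0 + s', a₂'', …)` holds and is subabundant, then
`T(n; s; a)` holds and is subabundant. -/
theorem subabundance_theorem
    (K : Type*) [Field K] [CharZero K] {k : ℕ} (hk : 0 < k)
    (n : Fin k → ℕ) (n₁' n₁'' s s' s'' : ℕ) (a a' a'' : Fin k → ℕ)
    (hn : n ⟨0, hk⟩ = n₁' + n₁'' + 1)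
    (hs : s = s' + s'')
    (ha' : a' ⟨0, hk⟩ = a ⟨0, hk⟩ + s'')
    (ha'' : a'' ⟨0, hk⟩ = a ⟨0, hk⟩ + s')
    (ha : ∀ j : Fin k, j ≠ ⟨0, hk⟩ → a j = a' j + a'' j)
    (h1 : THolds K (Function.update n ⟨0, hk⟩ n₁') s' a' ∧
          Subabundant (Function.update n ⟨0, hk⟩ n₁') s' a')
    (h2 : THolds K (Function.update n ⟨0, hk⟩ n₁'') s'' a'' ∧
          Subabundant (Function.update n ⟨0, hk⟩ n₁'') s'' a'') :
    THolds K n s a ∧ Subabundant n s a := by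
  subst hs
  exact THolds.of_splitting ⟨0, hk⟩ (by simpa using hn)
    (fun i hi => Function.update_of_ne hi _ _) (fun i hi => Function.update_of_ne hi _ _)
    ha' ha'' ha h1.1 h1.2 h2.1 h2.2
end

section
/- (Superabundance Theorem.) Fix k ≥ 1 and natural numbers n₂, …, n_k. Suppose n₁ = n₁' + n₁'' + 1, s = s' + s'', and a_j = a_j' + a_j'' for j = 2, …, k. If the statement T(n₁', n₂, …, n_k; s'; a₁ + s'', a₂', …, a_k') holds and is superabundant, and the statement T(n₁'', n₂, …, n_k; s''; a₁ + s', a₂'', …, a_k'') holds and is superabundant, then the statement T(n₁, n₂, …, n_k; s; a₁, a₂, …, a_k) holds and is superabundant. -/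
open scoped TensorProduct

/-- Over a field, a subspace is everything iff it is contained in the kernel of no nonzero
linear form. -/
theorem Submodule.eq_top_iff_forall_dual {K V : Type*} [Field K] [AddCommGroup V] [Module K V]
    (W : Submodule K V) : W = ⊤ ↔ ∀ ψ : V →ₗ[K] K, W ≤ LinearMap.ker ψ → ψ = 0 := by
  constructor
  · rintro rfl ψ h
    exact LinearMap.ker_eq_top.mp (top_le_iff.mp h)
  · intro h
    by_contra hW
    obtain ⟨ψ, hψ, hle⟩ := W.exists_le_ker_of_lt_top (lt_top_iff_ne_top.mpr hW)
    exact hψ (h ψ hle)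

/-- If a family of vectors depending polynomially on a parameter spans a finite-dimensional space
for one value of the parameter, it does so for all but finitely many values. -/
theorem finite_setOf_span_range_ne_top {K V C : Type*} [Field K] [AddCommGroup V] [Module K V]
    [FiniteDimensional K V] (f : K → C → V)
    (hf : ∀ (ψ : V →ₗ[K] K) (c : C), ∃ P : Polynomial K, ∀ t, P.eval t = ψ (f t c))
    (t₀ : K) (h : Submodule.span K (Set.range (f t₀)) = ⊤) :
    {t | Submodule.span K (Set.range (f t)) ≠ ⊤}.Finite := by
  obtain ⟨g, hg, hspan, hli⟩ := Submodule.exists_fun_fin_finrank_span_eq K (Set.range (f t₀))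
  choose c hc using hg
  let b := Module.Basis.mk hli (by rw [hspan, h])
  have hb (i) : b i = f t₀ (c i) := by simp [b, hc]
  choose P hP using fun i j ↦ hf (b.coord i) (c j)
  set D : Polynomial K := (Matrix.of P).det
  have hD (t : K) : D.eval t = b.det (fun j ↦ f t (c j)) := by
    rw [Module.Basis.det_apply, ← Polynomial.coe_evalRingHom, RingHom.map_det]
    congr 1
    ext i j
    simp [hP, Module.Basis.toMatrix_apply]
  have hD0 : D ≠ 0 := by
    intro h0
    have := hD t₀
    rw [← funext hb, Module.Basis.det_self, h0] at this
    simp at this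
  refine (Polynomial.finite_setOfPred_isRoot hD0).subset fun t ht ↦ ?_
  by_contra hne
  rw [Set.mem_ofPred_eq, Polynomial.IsRoot, hD] at hne
  have := (b.is_basis_iff_det.mpr (isUnit_iff_ne_zero.mpr hne)).2
  exact ht (top_le_iff.mp (this ▸ Submodule.span_mono (by rintro _ ⟨i, rfl⟩; exact ⟨c i, rfl⟩)))

section Multilinear

variable {K ι : Type*} [Field K] {V : ι → Type*} [∀ i, AddCommGroup (V i)] [∀ i, Module K (V i)]

/-- A multilinear form restricted to an affine line is polynomial. -/
theorem MultilinearMap.exists_polynomial_eval_add_smul [Fintype ι] (φ : MultilinearMap K V K)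
    (m m' : ∀ i, V i) : ∃ P : Polynomial K, ∀ t, P.eval t = φ (m + t • m') := by
  classical
  refine ⟨∑ s : Finset ι, Polynomial.C (φ (s.piecewise m' m)) * Polynomial.X ^ s.card, fun t ↦ ?_⟩
  rw [add_comm m, φ.map_add_univ, Polynomial.eval_finsetSum]
  refine Finset.sum_congr rfl fun s _ ↦ ?_
  have h : s.piecewise (t • m') m
      = s.piecewise (fun i ↦ t • s.piecewise m' m i) (s.piecewise m' m) := by
    ext i
    by_cases hi : i ∈ s <;> simp [hi]
  rw [h, φ.map_piecewise_smul]
  simp only [Finset.prod_const, smul_eq_mul, Polynomial.eval_mul, Polynomial.eval_C,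
    Polynomial.eval_pow, Polynomial.eval_X, mul_comm]

variable [DecidableEq ι]

/-- The subspaces obtained from the pure tensors `pt c` by freeing the factor `slot c` span the
tensor product: no nonzero multilinear form vanishes on all of them. -/
def SpansTensors (K : Type*) [Field K] {V : ι → Type*} [∀ i, AddCommGroup (V i)]
    [∀ i, Module K (V i)] {C : Type*} (slot : C → ι) (pt : C → ∀ i, V i) : Prop :=
  ∀ φ : MultilinearMap K V K,
    (∀ c x, φ (Function.update (pt c) (slot c) x) = 0) → φ = 0

theorem spansTensors_iff_span_eq_top {C : Type*} (slot : C → ι) (pt : C → ∀ i, V i) :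
    SpansTensors K slot pt ↔ Submodule.span K (Set.range fun c : Σ c, V (slot c) ↦
      PiTensorProduct.tprod K (Function.update (pt c.1) (slot c.1) c.2)) = ⊤ := by
  rw [Submodule.eq_top_iff_forall_dual, SpansTensors,
    ← (PiTensorProduct.lift (R := K) (s := V) (E := K)).toEquiv.forall_congr_right]
  refine forall_congr' fun φ ↦ imp_congr ?_
    (EmbeddingLike.map_eq_zero_iff (f := PiTensorProduct.lift)).symm
  simp [Submodule.span_le, Set.range_subset_iff, Sigma.forall]

/-- Spanning is an open condition along affine lines. -/
theorem SpansTensors.finite_setOf_not [Fintype ι] [∀ i, FiniteDimensional K (V i)] {C : Type*}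
    {slot : C → ι} {pt : K → C → ∀ i, V i} (hpt : ∀ c, ∃ m m', ∀ t, pt t c = m + t • m')
    {t₀ : K} (h : SpansTensors K slot (pt t₀)) :
    {t | ¬ SpansTensors K slot (pt t)}.Finite := by
  simp_rw [spansTensors_iff_span_eq_top] at h ⊢
  refine finite_setOf_span_range_ne_top
    (fun t (c : Σ c, V (slot c)) ↦
      PiTensorProduct.tprod K (Function.update (pt t c.1) (slot c.1) c.2)) ?_ t₀ h
  rintro ψ ⟨c, x⟩
  obtain ⟨m, m', hm⟩ := hpt c
  obtain ⟨P, hP⟩ := (ψ.compMultilinearMap (PiTensorProduct.tprod K)).exists_polynomial_eval_add_smul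
    (Function.update m (slot c) x) (Function.update m' (slot c) 0)
  refine ⟨P, fun t ↦ ?_⟩
  rw [hP, hm, ← Function.update_smul, smul_zero, ← Function.update_add, add_zero]
  rfl

/-- The multilinear form `φ` vanishes on the subspace freeing factor `i` in `⨂ v` as soon as
it does for `⨂ v'`, where `v'` is `v` with the zero components replaced. -/
theorem MultilinearMap.map_update_eq_zero_of_ite [∀ i, DecidableEq (V i)]
    (φ : MultilinearMap K V K) (v w : ∀ i, V i) (i : ι)
    (h : ∀ x, φ (Function.update (fun j ↦ if v j = 0 then w j else v j) i x) = 0) (x : V i) :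
    φ (Function.update v i x) = 0 := by
  by_cases hv : ∃ j, j ≠ i ∧ v j = 0
  · obtain ⟨j, hji, hj⟩ := hv
    exact φ.map_coord_zero j (by simp [hji, hj])
  · push Not at hv
    rw [← h x]
    congr 1
    ext j
    by_cases hj : j = i
    · subst hj; simp
    · simp [hj, hv j hj]

variable {V' V'' : ι → Type*} [∀ i, AddCommGroup (V' i)] [∀ i, Module K (V' i)]
  [∀ i, AddCommGroup (V'' i)] [∀ i, Module K (V'' i)]

theorem SpansTensors.compLinearMap_eq_zero {C : Type*} {slot : C → ι} {pt : C → ∀ i, V i}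
    {proj : ∀ i, V i →ₗ[K] V' i} (incl : ∀ i, V' i →ₗ[K] V i)
    (h : SpansTensors K slot (fun c i ↦ proj i (pt c i))) (φ : MultilinearMap K V K)
    (hφ : ∀ c x, φ (Function.update (fun i ↦ incl i (proj i (pt c i))) (slot c) x) = 0) :
    φ.compLinearMap incl = 0 := by
  refine h _ fun c x ↦ ?_
  rw [MultilinearMap.compLinearMap_apply, ← hφ c (incl _ x)]
  congr 1
  ext i
  by_cases hi : i = slot c
  · subst hi; simp
  · simp [hi]

/-- Splitting one factor `V i₀` as `V' i₀ ⊕ V'' i₀`: spanning configurations for the two summands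
can be moved into a position where they combine to a spanning configuration. -/
theorem SpansTensors.exists_glue [Fintype ι] [Infinite K]
    [∀ i, FiniteDimensional K (V' i)] [∀ i, FiniteDimensional K (V'' i)] (i₀ : ι)
    (proj' : ∀ i, V i →ₗ[K] V' i) (incl' : ∀ i, V' i →ₗ[K] V i)
    (proj'' : ∀ i, V i →ₗ[K] V'' i) (incl'' : ∀ i, V'' i →ₗ[K] V i)
    (hpi' : ∀ i y, proj' i (incl' i y) = y) (hpi'' : ∀ i y, proj'' i (incl'' i y) = y)
    (hip' : ∀ i ≠ i₀, ∀ y, incl' i (proj' i y) = y)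
    (hip'' : ∀ i ≠ i₀, ∀ y, incl'' i (proj'' i y) = y)
    (hadd : ∀ y, incl' i₀ (proj' i₀ y) + incl'' i₀ (proj'' i₀ y) = y)
    {S' S'' A Q' Q'' : Type*} (slot' : Q' → ι) (slot'' : Q'' → ι)
    (p' : S' → ∀ i, V' i) (r' : A ⊕ S'' → ∀ i, V' i) (q' : Q' → ∀ i, V' i)
    (p'' : S'' → ∀ i, V'' i) (r'' : A ⊕ S' → ∀ i, V'' i) (q'' : Q'' → ∀ i, V'' i)
    (h' : SpansTensors K
      (Sum.elim (fun c : S' × ι ↦ c.2) (Sum.elim (fun _ : A ⊕ S'' ↦ i₀) slot'))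
      (Sum.elim (fun c ↦ p' c.1) (Sum.elim r' q')))
    (h'' : SpansTensors K
      (Sum.elim (fun c : S'' × ι ↦ c.2) (Sum.elim (fun _ : A ⊕ S' ↦ i₀) slot''))
      (Sum.elim (fun c ↦ p'' c.1) (Sum.elim r'' q''))) :
    ∃ (x : S' → ∀ i, V i) (y : S'' → ∀ i, V i) (z : A → ∀ i, V i)
      (u' : Q' → ∀ i, V i) (u'' : Q'' → ∀ i, V i), ∀ φ : MultilinearMap K V K,
      (∀ j i w, φ (Function.update (x j) i w) = 0) →
      (∀ j i w, φ (Function.update (y j) i w) = 0) →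
      (∀ j w, φ (Function.update (z j) i₀ w) = 0) →
      (∀ j w, φ (Function.update (u' j) (slot' j) w) = 0) →
      (∀ j w, φ (Function.update (u'' j) (slot'' j) w) = 0) → φ = 0 := by
  let line (f : ∀ i, V' i) (g : ∀ i, V'' i) (t : K) : ∀ i, V i :=
    (fun i ↦ incl' i (f i)) + t • fun i ↦ incl'' i (g i) - incl' i (f i)
  have hline0 (f g) (i : ι) : proj' i (line f g 0 i) = f i := by simp [line, hpi']
  have hline1 (f g) (i : ι) : proj'' i (line f g 1 i) = g i := by simp [line, hpi'']
  let x (t : K) (j : S') : ∀ i, V i := line (p' j) (r'' (.inr j)) t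
  let y (t : K) (j : S'') : ∀ i, V i := line (r' (.inr j)) (p'' j) t
  let z (t : K) (j : A) : ∀ i, V i := line (r' (.inl j)) (r'' (.inl j)) t
  let pt' (t : K) : S' × ι ⊕ (A ⊕ S'') ⊕ Q' → ∀ i, V i :=
    Sum.elim (fun c ↦ x t c.1) (Sum.elim (Sum.elim (z t) (y t)) fun j i ↦ incl' i (q' j i))
  let pt'' (t : K) : S'' × ι ⊕ (A ⊕ S') ⊕ Q'' → ∀ i, V i :=
    Sum.elim (fun c ↦ y t c.1) (Sum.elim (Sum.elim (z t) (x t)) fun j i ↦ incl'' i (q'' j i))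
  have haff' (c) : ∃ m m' : ∀ i, V i, ∀ t, pt' t c = m + t • m' := by
    rcases c with c | (c | c) | c
    iterate 3 exact ⟨_, _, fun _ ↦ rfl⟩
    exact ⟨_, 0, fun t ↦ by rw [smul_zero, add_zero]; rfl⟩
  have haff'' (c) : ∃ m m' : ∀ i, V i, ∀ t, pt'' t c = m + t • m' := by
    rcases c with c | (c | c) | c
    iterate 3 exact ⟨_, _, fun _ ↦ rfl⟩
    exact ⟨_, 0, fun t ↦ by rw [smul_zero, add_zero]; rfl⟩
  have hfin' := SpansTensors.finite_setOf_not (K := K) (t₀ := 0)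
    (pt := fun t c i ↦ proj' i (pt' t c i))
    (fun c ↦ by
      obtain ⟨m, m', h⟩ := haff' c
      exact ⟨fun i ↦ proj' i (m i), fun i ↦ proj' i (m' i), fun t ↦ by ext i; simp [h]⟩)
    (by
      convert h' using 1
      funext c i
      rcases c with c | (c | c) | c
      iterate 3 exact hline0 _ _ _
      exact hpi' _ _)
  have hfin'' := SpansTensors.finite_setOf_not (K := K) (t₀ := 1)
    (pt := fun t c i ↦ proj'' i (pt'' t c i))
    (fun c ↦ by
      obtain ⟨m, m', h⟩ := haff'' c
      exact ⟨fun i ↦ proj'' i (m i), fun i ↦ proj'' i (m' i), fun t ↦ by ext i; simp [h]⟩)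
    (by
      convert h'' using 1
      funext c i
      rcases c with c | (c | c) | c
      iterate 3 exact hline1 _ _ _
      exact hpi'' _ _)
  obtain ⟨t, ht⟩ := (hfin'.union hfin'').infinite_compl.nonempty
  simp only [Set.mem_compl_iff, Set.mem_union, Set.mem_ofPred_eq, not_or, not_not] at ht
  refine ⟨fun j i ↦ incl' i (proj' i (x t j i)), fun j i ↦ incl'' i (proj'' i (y t j i)), z t,
    fun j i ↦ incl' i (q' j i), fun j i ↦ incl'' i (q'' j i), fun φ hx hy hz hu' hu'' ↦ ?_⟩
  have hoff' (v : ∀ i, V i) (w : V i₀) :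
      Function.update (fun i ↦ incl' i (proj' i (v i))) i₀ w = Function.update v i₀ w := by
    ext i
    by_cases hi : i = i₀
    · subst hi; simp
    · simp [hi, hip' i hi]
  have hoff'' (v : ∀ i, V i) (w : V i₀) :
      Function.update (fun i ↦ incl'' i (proj'' i (v i))) i₀ w = Function.update v i₀ w := by
    ext i
    by_cases hi : i = i₀
    · subst hi; simp
    · simp [hi, hip'' i hi]
  have hφ' := ht.1.compLinearMap_eq_zero incl' φ (by
    rintro (c | (c | c) | c) w
    · exact hx _ _ _
    · exact (congrArg φ (hoff' _ w)).trans (hz c w)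
    · exact (congrArg φ ((hoff' _ w).trans (hoff'' _ w).symm)).trans (hy c i₀ w)
    · simpa only [pt', Sum.elim_inr, hpi'] using hu' c w)
  have hφ'' := ht.2.compLinearMap_eq_zero incl'' φ (by
    rintro (c | (c | c) | c) w
    · exact hy _ _ _
    · exact (congrArg φ (hoff'' _ w)).trans (hz c w)
    · exact (congrArg φ ((hoff'' _ w).trans (hoff' _ w).symm)).trans (hx c i₀ w)
    · simpa only [pt'', Sum.elim_inr, hpi''] using hu'' c w)
  ext v
  have hv' := congrArg (fun ψ ↦ ψ fun i ↦ proj' i (v i)) hφ'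
  have hv'' := congrArg (fun ψ ↦ ψ fun i ↦ proj'' i (v i)) hφ''
  simp only [MultilinearMap.compLinearMap_apply, zero_apply] at hv' hv''
  rw [← Function.update_eq_self i₀ fun i ↦ incl' i (proj' i (v i)), hoff'] at hv'
  rw [← Function.update_eq_self i₀ fun i ↦ incl'' i (proj'' i (v i)), hoff''] at hv''
  rw [← Function.update_eq_self i₀ v, ← hadd (v i₀), φ.map_update_add, hv', hv'', add_zero,
    zero_apply]

end Multilinear

section Segre

variable {K : Type*} [Field K] {k : ℕ} {n : Fin k → ℕ} {s : ℕ} {a : Fin k → ℕ}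

theorem segreG_le_ker_iff (v : ∀ i, Fin (n i + 1) → K) (i : Fin k)
    (ψ : (⨂[K] i, (Fin (n i + 1) → K)) →ₗ[K] K) :
    segreG K n v i ≤ LinearMap.ker ψ ↔
      ∀ x, ψ (PiTensorProduct.tprod K (Function.update v i x)) = 0 := by
  rw [segreG, LinearMap.range_le_ker_iff, LinearMap.ext_iff]
  rfl

theorem iSup_segre_eq_top_iff (p : Fin s → ∀ i, Fin (n i + 1) → K)
    (q : ∀ i : Fin k, Fin (a i) → ∀ j, Fin (n j + 1) → K) :
    (((⨆ j, segreTangent K n (p j)) ⊔ (⨆ i, ⨆ l, segreG K n (q i l) i))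
        : Submodule K (⨂[K] i, (Fin (n i + 1) → K))) = ⊤ ↔
      ∀ φ : MultilinearMap K (fun i ↦ Fin (n i + 1) → K) K,
        (∀ j i x, φ (Function.update (p j) i x) = 0) →
        (∀ i l x, φ (Function.update (q i l) i x) = 0) → φ = 0 := by
  rw [Submodule.eq_top_iff_forall_dual, ← (PiTensorProduct.lift (R := K)
    (s := fun i ↦ Fin (n i + 1) → K) (E := K)).toEquiv.forall_congr_right]
  refine forall_congr' fun φ ↦ Iff.trans (imp_congr ?_
    (EmbeddingLike.map_eq_zero_iff (f := PiTensorProduct.lift))) and_imp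
  simp [segreTangent, segreG_le_ker_iff]

theorem finrank_piTensorProduct_segre (K : Type*) [Field K] {k : ℕ} (n : Fin k → ℕ) :
    Module.finrank K (⨂[K] i, (Fin (n i + 1) → K)) = ∏ i, (n i + 1) := by
  rw [Module.finrank_eq_card_basis
    (Basis.piTensorProduct fun i ↦ Pi.basisFun K (Fin (n i + 1))), Fintype.card_pi]
  simp

/-- For a superabundant tuple, `THolds` says that some configuration of points, possibly with zero
components, is annihilated by no nonzero multilinear form. -/
theorem Superabundant.tHolds_iff (h : Superabundant n s a) :
    THolds K n s a ↔ ∃ (p : Fin s → ∀ i, Fin (n i + 1) → K)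
      (q : ∀ i : Fin k, Fin (a i) → ∀ j, Fin (n j + 1) → K),
      ∀ φ : MultilinearMap K (fun i ↦ Fin (n i + 1) → K) K,
        (∀ j i x, φ (Function.update (p j) i x) = 0) →
        (∀ i l x, φ (Function.update (q i l) i x) = 0) → φ = 0 := by
  rw [THolds, min_eq_right h, ← finrank_piTensorProduct_segre K n]
  constructor
  · rintro ⟨p, q, -, -, hpq⟩
    exact ⟨p, q, (iSup_segre_eq_top_iff p q).mp (Submodule.eq_top_of_finrank_eq hpq)⟩
  · rintro ⟨p, q, hpq⟩
    classical
    let fix (v : ∀ i, Fin (n i + 1) → K) (i : Fin k) : Fin (n i + 1) → K :=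
      if v i = 0 then 1 else v i
    have hfix (v i) : fix v i ≠ 0 := by
      by_cases hv : v i = 0 <;> simp [fix, hv]
    refine ⟨fun j ↦ fix (p j), fun i l ↦ fix (q i l), fun j ↦ hfix _, fun i l ↦ hfix _, ?_⟩
    rw [(iSup_segre_eq_top_iff _ _).mpr, finrank_top]
    exact fun φ hp hq ↦ hpq φ (fun j i ↦ φ.map_update_eq_zero_of_ite _ _ _ (hp j i))
      fun i l ↦ φ.map_update_eq_zero_of_ite _ _ _ (hq i l)

theorem Superabundant.of_update (i₀ : Fin k) {n₁' n₁'' s' s'' : ℕ} {a' a'' : Fin k → ℕ}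
    (hn : n i₀ = n₁' + n₁'' + 1) (hs : s = s' + s'')
    (ha' : a' i₀ = a i₀ + s'') (ha'' : a'' i₀ = a i₀ + s')
    (ha : ∀ j, j ≠ i₀ → a j = a' j + a'' j)
    (h' : Superabundant (Function.update n i₀ n₁') s' a')
    (h'' : Superabundant (Function.update n i₀ n₁'') s'' a'') : Superabundant n s a := by
  have hupd {m : ℕ} {j : Fin k} (hj : j ∈ Finset.univ.erase i₀) :
      Function.update n i₀ m j = n j := by simp [Finset.ne_of_mem_erase hj]
  have hsum (m : ℕ) : ∑ i, Function.update n i₀ m i = m + ∑ i ∈ Finset.univ.erase i₀, n i := by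
    rw [← Finset.add_sum_erase _ _ (Finset.mem_univ i₀), Function.update_self,
      Finset.sum_congr rfl fun j hj ↦ hupd hj]
  have hprod (m : ℕ) : ∏ i, (Function.update n i₀ m i + 1)
      = (m + 1) * ∏ i ∈ Finset.univ.erase i₀, (n i + 1) := by
    rw [← Finset.mul_prod_erase _ _ (Finset.mem_univ i₀), Function.update_self,
      Finset.prod_congr rfl fun j hj ↦ by rw [hupd hj]]
  have hslots (m : ℕ) (b : Fin k → ℕ) : ∑ i, b i * (Function.update n i₀ m i + 1)
      = b i₀ * (m + 1) + ∑ i ∈ Finset.univ.erase i₀, b i * (n i + 1) := by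
    rw [← Finset.add_sum_erase _ _ (Finset.mem_univ i₀), Function.update_self,
      Finset.sum_congr rfl fun j hj ↦ by rw [hupd hj]]
  have hsplit : ∑ i ∈ Finset.univ.erase i₀, a i * (n i + 1)
      = ∑ i ∈ Finset.univ.erase i₀, a' i * (n i + 1)
        + ∑ i ∈ Finset.univ.erase i₀, a'' i * (n i + 1) := by
    rw [← Finset.sum_add_distrib]
    exact Finset.sum_congr rfl fun j hj ↦ by rw [ha j (Finset.ne_of_mem_erase hj), add_mul]
  have hself := Function.update_eq_self i₀ n
  rw [← hself]
  simp only [Superabundant, hsum, hprod, hslots, hsplit, hn, hs, ha', ha''] at h' h'' ⊢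
  nlinarith

/-- Splittings of the factors: the factor `i₀` is a direct sum, the others are unchanged. -/
theorem exists_factor_splitting (K : Type*) [Field K] (i₀ : Fin k) {n₁' n₁'' : ℕ}
    (hn : n i₀ = n₁' + n₁'' + 1) (i : Fin k) :
    ∃ (proj' : (Fin (n i + 1) → K) →ₗ[K] (Fin (Function.update n i₀ n₁' i + 1) → K))
      (incl' : (Fin (Function.update n i₀ n₁' i + 1) → K) →ₗ[K] (Fin (n i + 1) → K))
      (proj'' : (Fin (n i + 1) → K) →ₗ[K] (Fin (Function.update n i₀ n₁'' i + 1) → K))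
      (incl'' : (Fin (Function.update n i₀ n₁'' i + 1) → K) →ₗ[K] (Fin (n i + 1) → K)),
      (∀ y, proj' (incl' y) = y) ∧ (∀ y, proj'' (incl'' y) = y) ∧
      (i ≠ i₀ → ∀ y, incl' (proj' y) = y) ∧ (i ≠ i₀ → ∀ y, incl'' (proj'' y) = y) ∧
      (i = i₀ → ∀ y, incl' (proj' y) + incl'' (proj'' y) = y) := by
  by_cases hi : i = i₀
  · subst hi
    let e : (Fin (n i + 1) → K) ≃ₗ[K] (Fin (Function.update n i n₁' i + 1) → K) ×
        (Fin (Function.update n i n₁'' i + 1) → K) :=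
      LinearEquiv.ofFinrankEq _ _ (by simp [hn]; ring)
    refine ⟨.fst K _ _ ∘ₗ e.toLinearMap, e.symm.toLinearMap ∘ₗ .inl K _ _,
      .snd K _ _ ∘ₗ e.toLinearMap, e.symm.toLinearMap ∘ₗ .inr K _ _,
      by simp, by simp, by simp, by simp, fun _ y ↦ ?_⟩
    simp [← map_add]
  · let e' : (Fin (n i + 1) → K) ≃ₗ[K] (Fin (Function.update n i₀ n₁' i + 1) → K) :=
      LinearEquiv.ofFinrankEq _ _ (by simp [hi])
    let e'' : (Fin (n i + 1) → K) ≃ₗ[K] (Fin (Function.update n i₀ n₁'' i + 1) → K) :=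
      LinearEquiv.ofFinrankEq _ _ (by simp [hi])
    exact ⟨e'.toLinearMap, e'.symm.toLinearMap, e''.toLinearMap, e''.symm.toLinearMap,
      by simp, by simp, by simp, by simp, by simp [hi]⟩

/-- Reindexing of a configuration so that the points attached to the factor `i₀` come in two
groups and the remaining ones are listed separately. -/
theorem spansTensors_sumElim (i₀ : Fin k) {A T : ℕ} (hA : a i₀ = A + T)
    {p : Fin s → ∀ i, Fin (n i + 1) → K} {q : ∀ i : Fin k, Fin (a i) → ∀ j, Fin (n j + 1) → K}
    (h : ∀ φ : MultilinearMap K (fun i ↦ Fin (n i + 1) → K) K,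
        (∀ j i x, φ (Function.update (p j) i x) = 0) →
        (∀ i l x, φ (Function.update (q i l) i x) = 0) → φ = 0) :
    SpansTensors K
      (Sum.elim (fun c : Fin s × Fin k ↦ c.2) (Sum.elim (fun _ : Fin A ⊕ Fin T ↦ i₀)
        fun c : Σ j : {j // j ≠ i₀}, Fin (a j) ↦ c.1.1))
      (Sum.elim (fun c ↦ p c.1) (Sum.elim
        (fun c ↦ q i₀ (finCongr hA.symm (finSumFinEquiv c))) fun c ↦ q c.1 c.2)) := by
  refine fun φ hφ ↦ h φ (fun j i x ↦ hφ (.inl (j, i)) x) fun i l x ↦ ?_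
  by_cases hi : i = i₀
  · subst hi
    simpa using hφ (.inr (.inl (finSumFinEquiv.symm (finCongr hA l)))) x
  · exact hφ (.inr (.inr ⟨⟨i, hi⟩, l⟩)) x

end Segre

/-- Superabundance Theorem.  Suppose `n 0 = n₁' + n₁'' + 1`,
`s = s' + s''`, `a j = a' j + a'' j` for `j ≠ 0`, `a' 0 = a 0 + s''` and
`a'' 0 = a 0 + s'`.  If `T(n₁', n₂, …; s'; a 0 + s'', a₂', …)` holds and is superabundant
and `T(n₁'', n₂, …; s''; a 0 + s', a₂'', …)` holds and is superabundant, then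
`T(n; s; a)` holds and is superabundant. -/
theorem superabundance_theorem
    (K : Type*) [Field K] [CharZero K] {k : ℕ} (hk : 0 < k)
    (n : Fin k → ℕ) (n₁' n₁'' s s' s'' : ℕ) (a a' a'' : Fin k → ℕ)
    (hn : n ⟨0, hk⟩ = n₁' + n₁'' + 1)
    (hs : s = s' + s'')
    (ha' : a' ⟨0, hk⟩ = a ⟨0, hk⟩ + s'')
    (ha'' : a'' ⟨0, hk⟩ = a ⟨0, hk⟩ + s')
    (ha : ∀ j : Fin k, j ≠ ⟨0, hk⟩ → a j = a' j + a'' j)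
    (h1 : THolds K (Function.update n ⟨0, hk⟩ n₁') s' a' ∧
          Superabundant (Function.update n ⟨0, hk⟩ n₁') s' a')
    (h2 : THolds K (Function.update n ⟨0, hk⟩ n₁'') s'' a'' ∧
          Superabundant (Function.update n ⟨0, hk⟩ n₁'') s'' a'') :
    THolds K n s a ∧ Superabundant n s a := by
  have hsup := h1.2.of_update ⟨0, hk⟩ hn hs ha' ha'' ha h2.2
  refine ⟨hsup.tHolds_iff.mpr ?_, hsup⟩
  obtain ⟨p', q', hpq'⟩ := h1.2.tHolds_iff.mp h1.1
  obtain ⟨p'', q'', hpq''⟩ := h2.2.tHolds_iff.mp h2.1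
  generalize (⟨0, hk⟩ : Fin k) = i₀ at *
  choose proj' incl' proj'' incl'' hpi' hpi'' hip' hip'' hadd using
    exists_factor_splitting K i₀ hn
  obtain ⟨x, y, z, u', u'', hglue⟩ := SpansTensors.exists_glue i₀ proj' incl' proj'' incl''
    hpi' hpi'' hip' hip'' (hadd i₀ rfl) _ _ _ _ _ _ _ _
    (spansTensors_sumElim i₀ ha' hpq') (spansTensors_sumElim i₀ ha'' hpq'')
  have hq (i : Fin k) : ∃ f : Fin (a i) → ∀ j, Fin (n j + 1) → K,
      (i = i₀ → ∀ l, ∃ m, f m = z l) ∧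
      (∀ hi : i ≠ i₀, (∀ l, ∃ m, f m = u' ⟨⟨i, hi⟩, l⟩) ∧ ∀ l, ∃ m, f m = u'' ⟨⟨i, hi⟩, l⟩) := by
    by_cases hi : i = i₀
    · subst hi
      exact ⟨z, fun _ l ↦ ⟨l, rfl⟩, fun h ↦ absurd rfl h⟩
    · let e := finSumFinEquiv.trans (finCongr (ha i hi).symm)
      exact ⟨fun m ↦ Sum.elim (fun l ↦ u' ⟨⟨i, hi⟩, l⟩) (fun l ↦ u'' ⟨⟨i, hi⟩, l⟩) (e.symm m),
        fun h ↦ absurd h hi, fun _ ↦ ⟨fun l ↦ ⟨e (.inl l), by simp⟩, fun l ↦ ⟨e (.inr l), by simp⟩⟩⟩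
  choose q hqz hqu using hq
  let e := finSumFinEquiv.trans (finCongr hs.symm)
  refine ⟨fun j ↦ Sum.elim x y (e.symm j), q, fun φ hφp hφq ↦ hglue φ ?_ ?_ ?_ ?_ ?_⟩
  · exact fun j ↦ by simpa using hφp (e (.inl j))
  · exact fun j ↦ by simpa using hφp (e (.inr j))
  · intro l
    obtain ⟨m, hm⟩ := hqz i₀ rfl l
    exact hm ▸ hφq i₀ m
  · rintro ⟨⟨i, hi⟩, l⟩
    obtain ⟨m, hm⟩ := (hqu i hi).1 l
    exact hm ▸ hφq i m
  · rintro ⟨⟨i, hi⟩, l⟩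
    obtain ⟨m, hm⟩ := (hqu i hi).2 l
    exact hm ▸ hφq i m
end

section
/- (Strassen monotonicity.) Let (n₁,…,n_k) and (n₁',…,n_k') be k-tuples of natural numbers. (i) If the statement T(n₁,…,n_k; s; a₁,…,a_k) holds and is subabundant, and n_i' ≥ n_i for every i, then T(n₁',…,n_k'; s; a₁,…,a_k) holds and is subabundant. (ii) If T(n₁,…,n_k; s; a₁,…,a_k) holds and is superabundant, and n_i' ≤ n_i for every i, then T(n₁',…,n_k'; s; a₁,…,a_k) holds and is superabundant. -/
open scoped TensorProduct

section SegreParametrization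

open Function PiTensorProduct

variable {K : Type*} [Field K] {k s : ℕ} {n n' a : Fin k → ℕ}

/-- The span of the tangent spaces at the points `p j` and of the subspaces `G^i` at the
points `q i l`. -/
noncomputable abbrev segreSpan (p : Fin s → ∀ i, Fin (n i + 1) → K)
    (q : ∀ i : Fin k, Fin (a i) → ∀ j, Fin (n j + 1) → K) :
    Submodule K (⨂[K] i, (Fin (n i + 1) → K)) :=
  (⨆ j, segreTangent K n (p j)) ⊔ (⨆ i, ⨆ l, segreG K n (q i l) i)

/-- The parameters for `segreSpan`: a multiple of each point `p j`, tangent directions in chosen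
hyperplanes `ker (lam j i)`, and arbitrary directions at the points `q i l`. -/
abbrev SegreParam (a : Fin k → ℕ) (lam : Fin s → ∀ i, (Fin (n i + 1) → K) →ₗ[K] K) : Type _ :=
  (Fin s → K) × (∀ j i, LinearMap.ker (lam j i)) × (∀ i, Fin (a i) → Fin (n i + 1) → K)

/-- The linear map parametrizing `segreSpan`. -/
noncomputable def segreParamMap (lam : Fin s → ∀ i, (Fin (n i + 1) → K) →ₗ[K] K)
    (p : Fin s → ∀ i, Fin (n i + 1) → K)
    (q : ∀ i : Fin k, Fin (a i) → ∀ j, Fin (n j + 1) → K) :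
    SegreParam a lam →ₗ[K] ⨂[K] i, (Fin (n i + 1) → K) where
  toFun z := ∑ j, z.1 j • tprod K (p j) + ∑ j, ∑ i, tprod K (update (p j) i (z.2.1 j i)) +
    ∑ i, ∑ l, tprod K (update (q i l) i (z.2.2 i l))
  map_add' z w := by
    simp only [Prod.fst_add, Prod.snd_add, Pi.add_apply, Submodule.coe_add,
      MultilinearMap.map_update_add, add_smul, Finset.sum_add_distrib]
    abel
  map_smul' c z := by
    simp only [Prod.smul_fst, Prod.smul_snd, Pi.smul_apply, Submodule.coe_smul,
      MultilinearMap.map_update_smul, smul_add, Finset.smul_sum, smul_eq_mul, mul_smul,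
      RingHom.id_apply]

theorem segreParamMap_apply (lam : Fin s → ∀ i, (Fin (n i + 1) → K) →ₗ[K] K)
    (p : Fin s → ∀ i, Fin (n i + 1) → K)
    (q : ∀ i : Fin k, Fin (a i) → ∀ j, Fin (n j + 1) → K) (z : SegreParam a lam) :
    segreParamMap lam p q z =
      ∑ j, z.1 j • tprod K (p j) + ∑ j, ∑ i, tprod K (update (p j) i (z.2.1 j i)) +
        ∑ i, ∑ l, tprod K (update (q i l) i (z.2.2 i l)) := rfl

theorem tprod_update_mem_segreG (v : ∀ i, Fin (n i + 1) → K) (i : Fin k)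
    (x : Fin (n i + 1) → K) : tprod K (update v i x) ∈ segreG K n v i :=
  ⟨x, rfl⟩

theorem tprod_mem_segreG (v : ∀ i, Fin (n i + 1) → K) (i : Fin k) :
    tprod K v ∈ segreG K n v i := by
  simpa using tprod_update_mem_segreG v i (v i)

theorem segreG_le_segreSpan_left (p : Fin s → ∀ i, Fin (n i + 1) → K)
    (q : ∀ i : Fin k, Fin (a i) → ∀ j, Fin (n j + 1) → K) (j : Fin s) (i : Fin k) :
    segreG K n (p j) i ≤ segreSpan p q :=
  le_sup_of_le_left (le_iSup_of_le j (le_iSup (fun i => segreG K n (p j) i) i))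

theorem segreG_le_segreSpan_right (p : Fin s → ∀ i, Fin (n i + 1) → K)
    (q : ∀ i : Fin k, Fin (a i) → ∀ j, Fin (n j + 1) → K) (i : Fin k) (l : Fin (a i)) :
    segreG K n (q i l) i ≤ segreSpan p q :=
  le_sup_of_le_right (le_iSup_of_le i (le_iSup (fun l => segreG K n (q i l) i) l))

theorem segreSpan_le {p : Fin s → ∀ i, Fin (n i + 1) → K}
    {q : ∀ i : Fin k, Fin (a i) → ∀ j, Fin (n j + 1) → K}
    {W : Submodule K (⨂[K] i, (Fin (n i + 1) → K))}
    (hp : ∀ j i x, tprod K (update (p j) i x) ∈ W)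
    (hq : ∀ i l x, tprod K (update (q i l) i x) ∈ W) : segreSpan p q ≤ W := by
  refine sup_le (iSup_le fun j => iSup_le fun i => ?_) (iSup_le fun i => iSup_le fun l => ?_)
  · rintro _ ⟨x, rfl⟩
    exact hp j i x
  · rintro _ ⟨x, rfl⟩
    exact hq i l x

theorem range_segreParamMap [NeZero k] {lam : Fin s → ∀ i, (Fin (n i + 1) → K) →ₗ[K] K}
    {p : Fin s → ∀ i, Fin (n i + 1) → K}
    (q : ∀ i : Fin k, Fin (a i) → ∀ j, Fin (n j + 1) → K)
    (hlam : ∀ j i, lam j i (p j i) = 1) :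
    LinearMap.range (segreParamMap lam p q) = segreSpan p q := by
  apply le_antisymm
  · rintro _ ⟨z, rfl⟩
    rw [segreParamMap_apply]
    refine add_mem (add_mem (sum_mem fun j _ => ?_) (sum_mem fun j _ => sum_mem fun i _ => ?_))
      (sum_mem fun i _ => sum_mem fun l _ => ?_)
    · exact Submodule.smul_mem _ _ (segreG_le_segreSpan_left p q j 0 (tprod_mem_segreG _ _))
    · exact segreG_le_segreSpan_left p q j i (tprod_update_mem_segreG _ _ _)
    · exact segreG_le_segreSpan_right p q i l (tprod_update_mem_segreG _ _ _)
  · refine segreSpan_le (fun j i x => ?_) (fun i l x => ?_)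
    · refine ⟨(Pi.single j (lam j i x),
        Pi.single j (Pi.single i ⟨x - lam j i x • p j i, by simp [hlam]⟩), 0), ?_⟩
      rw [segreParamMap_apply, Finset.sum_eq_single j, Finset.sum_eq_single j,
        Finset.sum_eq_single i]
      · simp [MultilinearMap.map_update_sub, MultilinearMap.map_update_smul]
      · intro b _ hb
        simp [hb]
      · simp
      · intro b _ hb
        simp [hb]
      · simp
      · intro b _ hb
        simp [hb]
      · simp
    · refine ⟨(0, 0, Pi.single i (Pi.single l x)), ?_⟩
      rw [segreParamMap_apply, Finset.sum_eq_single (a := i), Finset.sum_eq_single (a := l)]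
      · simp
      · intro b _ hb
        simp [hb]
      · simp
      · intro b _ hb
        simp [hb]
      · simp

theorem finrank_segreParam {lam : Fin s → ∀ i, (Fin (n i + 1) → K) →ₗ[K] K}
    (hlam : ∀ j i, lam j i ≠ 0) :
    Module.finrank K (SegreParam a lam) = s * (1 + ∑ i, n i) + ∑ i, a i * (n i + 1) := by
  have hker (j : Fin s) (i : Fin k) : Module.finrank K (LinearMap.ker (lam j i)) = n i := by
    have := Module.Dual.finrank_ker_add_one_of_ne_zero (hlam j i)
    simpa using this
  simp [SegreParam, Module.finrank_pi_fintype, hker]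
  ring

theorem exists_dual_apply_eq_one {p : Fin s → ∀ i, Fin (n i + 1) → K} (hp : ∀ j i, p j i ≠ 0) :
    ∃ lam : Fin s → ∀ i, (Fin (n i + 1) → K) →ₗ[K] K, ∀ j i, lam j i (p j i) = 1 := by
  choose lam hlam using fun j i => Module.Projective.exists_dual_eq_one K (hp j i)
  exact ⟨lam, hlam⟩

theorem dual_ne_zero_of_apply_eq_one {p : Fin s → ∀ i, Fin (n i + 1) → K}
    {lam : Fin s → ∀ i, (Fin (n i + 1) → K) →ₗ[K] K} (hlam : ∀ j i, lam j i (p j i) = 1)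
    (j : Fin s) (i : Fin k) : lam j i ≠ 0 := by
  intro h
  simpa [h] using hlam j i

theorem finrank_piTensorProduct_fin (n : Fin k → ℕ) :
    Module.finrank K (⨂[K] i, (Fin (n i + 1) → K)) = ∏ i, (n i + 1) := by
  simp [Module.finrank_eq_card_basis
    (Basis.piTensorProduct fun i => Pi.basisFun K (Fin (n i + 1)))]

instance finiteDimensional_piTensorProduct_fin (n : Fin k → ℕ) :
    FiniteDimensional K (⨂[K] i, (Fin (n i + 1) → K)) :=
  (Basis.piTensorProduct fun i => Pi.basisFun K (Fin (n i + 1))).finiteDimensional_of_finite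

theorem finrank_segreSpan_le [NeZero k] {p : Fin s → ∀ i, Fin (n i + 1) → K}
    (q : ∀ i : Fin k, Fin (a i) → ∀ j, Fin (n j + 1) → K) (hp : ∀ j i, p j i ≠ 0) :
    Module.finrank K (segreSpan p q) ≤ s * (1 + ∑ i, n i) + ∑ i, a i * (n i + 1) := by
  obtain ⟨lam, hlam⟩ := exists_dual_apply_eq_one hp
  rw [← range_segreParamMap q hlam,
    ← finrank_segreParam (a := a) (dual_ne_zero_of_apply_eq_one hlam)]
  exact LinearMap.finrank_range_le _

/-- The parametrization is injective exactly when `segreSpan` has the largest dimension allowed by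
the number of parameters. -/
theorem finrank_segreSpan_eq_iff [NeZero k] {p : Fin s → ∀ i, Fin (n i + 1) → K}
    {lam : Fin s → ∀ i, (Fin (n i + 1) → K) →ₗ[K] K}
    (q : ∀ i : Fin k, Fin (a i) → ∀ j, Fin (n j + 1) → K)
    (hlam : ∀ j i, lam j i (p j i) = 1) :
    Module.finrank K (segreSpan p q) = s * (1 + ∑ i, n i) + ∑ i, a i * (n i + 1) ↔
      Injective (segreParamMap lam p q) := by
  rw [← range_segreParamMap q hlam,
    ← finrank_segreParam (a := a) (dual_ne_zero_of_apply_eq_one hlam), ← LinearMap.ker_eq_bot,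
    ← Submodule.finrank_eq_zero,
    ← LinearMap.finrank_range_add_finrank_ker (segreParamMap lam p q)]
  omega

theorem map_tprod_update {f : ∀ i, (Fin (n' i + 1) → K) →ₗ[K] (Fin (n i + 1) → K)}
    (v : ∀ i, Fin (n' i + 1) → K) (i : Fin k) (x : Fin (n' i + 1) → K) :
    PiTensorProduct.map f (tprod K (update v i x)) =
      tprod K (update (fun j => f j (v j)) i (f i x)) := by
  rw [map_tprod]
  congr 1
  ext1 j
  exact apply_update (fun j => f j) v i x j

/-- In a fixed tensor direction, injectivity of the parametrization forces arbitrary vectors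
placed at the points to be independent. -/
theorem eq_zero_of_sum_tprod_update_eq_zero {p : Fin s → ∀ i, Fin (n i + 1) → K}
    {lam : Fin s → ∀ i, (Fin (n i + 1) → K) →ₗ[K] K}
    {q : ∀ i : Fin k, Fin (a i) → ∀ j, Fin (n j + 1) → K}
    (hlam : ∀ j i, lam j i (p j i) = 1) (hinj : Injective (segreParamMap lam p q)) (i : Fin k)
    (x : Fin s → Fin (n i + 1) → K) (y : Fin (a i) → Fin (n i + 1) → K)
    (h : ∑ j, tprod K (update (p j) i (x j)) + ∑ l, tprod K (update (q i l) i (y l)) = 0) :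
    x = 0 ∧ y = 0 := by
  let z : SegreParam a lam := (fun j => lam j i (x j),
    fun j => Pi.single i ⟨x j - lam j i (x j) • p j i, by simp [hlam]⟩, Pi.single i y)
  have hz : z = 0 := by
    apply (injective_iff_map_eq_zero _).1 hinj
    rw [segreParamMap_apply, ← h, ← Finset.sum_add_distrib, Finset.sum_eq_single (a := i)]
    · congr 1
      · refine Finset.sum_congr rfl fun j _ => ?_
        rw [Finset.sum_eq_single i]
        · simp [z, MultilinearMap.map_update_sub, MultilinearMap.map_update_smul]
        · intro b _ hb
          simp [z, hb]
        · simp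
      · simp [z]
    · intro b _ hb
      simp [z, hb]
    · simp
  have h₁ (j : Fin s) : lam j i (x j) = 0 := congrFun (congrArg Prod.fst hz) j
  have h₂ (j : Fin s) : x j = 0 := by
    have := congrArg Subtype.val (congrFun (congrFun (congrArg (fun z => z.2.1) hz) j) i)
    simpa [z, h₁] using this
  refine ⟨funext h₂, ?_⟩
  simpa [z] using congrFun (congrArg (fun z => z.2.2) hz) i

/-- Extending the points by zero to larger vector spaces preserves injectivity of the
parametrization. -/
theorem injective_segreParamMap_of_section {p : Fin s → ∀ i, Fin (n i + 1) → K}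
    {lam : Fin s → ∀ i, (Fin (n i + 1) → K) →ₗ[K] K}
    {q : ∀ i : Fin k, Fin (a i) → ∀ j, Fin (n j + 1) → K}
    (hlam : ∀ j i, lam j i (p j i) = 1) (hinj : Injective (segreParamMap lam p q))
    {p' : Fin s → ∀ i, Fin (n' i + 1) → K}
    {q' : ∀ i : Fin k, Fin (a i) → ∀ j, Fin (n' j + 1) → K}
    (hn : ∀ i, n i + 1 ≤ n' i + 1)
    (hp : ∀ j i m, p' j i (Fin.castLE (hn i) m) = p j i m)
    (hq : ∀ i l j m, q' i l j (Fin.castLE (hn j) m) = q i l j m)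
    (hp₀ : ∀ j i m, n i + 1 ≤ m.val → p' j i m = 0)
    (hq₀ : ∀ i l j m, n j + 1 ≤ m.val → q' i l j m = 0) :
    Injective (segreParamMap
      (fun j i => (lam j i).comp (LinearMap.funLeft K K (Fin.castLE (hn i)))) p' q') := by
  rw [injective_iff_map_eq_zero]
  intro z hz
  let π (i : Fin k) : (Fin (n' i + 1) → K) →ₗ[K] (Fin (n i + 1) → K) :=
    LinearMap.funLeft K K (Fin.castLE (hn i))
  have hπp (j : Fin s) (i : Fin k) : π i (p' j i) = p j i := funext (hp j i)
  have hπq (i : Fin k) (l : Fin (a i)) (j : Fin k) : π j (q' i l j) = q i l j :=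
    funext (hq i l j)
  rw [segreParamMap_apply] at hz
  let w : SegreParam a lam := (z.1, fun j i => ⟨π i (z.2.1 j i), (z.2.1 j i).2⟩,
    fun i l => π i (z.2.2 i l))
  have hw : w = 0 := by
    apply (injective_iff_map_eq_zero _).1 hinj
    have := congrArg (PiTensorProduct.map π) hz
    simp only [map_add, map_sum, map_smul, map_tprod_update, map_zero] at this
    simp only [map_tprod, hπp, hπq] at this
    exact this
  have hc (j : Fin s) : z.1 j = 0 := congrFun (congrArg Prod.fst hw) j
  have hx (j : Fin s) (i : Fin k) : π i (z.2.1 j i) = 0 :=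
    congrArg Subtype.val (congrFun (congrFun (congrArg (fun w => w.2.1) hw) j) i)
  have hy (i : Fin k) (l : Fin (a i)) : π i (z.2.2 i l) = 0 :=
    congrFun (congrFun (congrArg (fun w => w.2.2) hw) i) l
  have key (i : Fin k) (m : Fin (n' i + 1)) (hm : n i + 1 ≤ m.val) :
      (∀ j, (z.2.1 j i : Fin (n' i + 1) → K) m = 0) ∧ ∀ l, z.2.2 i l m = 0 := by
    let φ : (Fin (n' i + 1) → K) →ₗ[K] (Fin (n i + 1) → K) :=
      (LinearMap.proj m).smulRight (1 : Fin (n i + 1) → K)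
    let f := update π i φ
    have hfi : f i = φ := update_self ..
    have hfj {j : Fin k} (hj : j ≠ i) : f j = π j := update_of_ne hj ..
    have hup (v : ∀ j, Fin (n' j + 1) → K) (u : ∀ j, Fin (n j + 1) → K)
        (hvu : ∀ j, π j (v j) = u j) (x : Fin (n i + 1) → K) :
        update (fun j => f j (v j)) i x = update u i x := by
      ext1 j
      rcases eq_or_ne j i with rfl | hj
      · simp
      · simp [hj, hfj hj, hvu]
    have hzero (v : ∀ j, Fin (n' j + 1) → K) (hv : v i m = 0) (b : Fin k) (hb : b ≠ i)
        (x : Fin (n b + 1) → K) : tprod K (update (fun j => f j (v j)) b x) = 0 := by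
      apply MultilinearMap.map_coord_zero _ i
      simp [hb.symm, hfi, φ, hv]
    have h := congrArg (PiTensorProduct.map f) hz
    simp only [hc, zero_smul, Finset.sum_const_zero, zero_add, map_add, map_sum,
      map_tprod_update, map_zero] at h
    rw [Finset.sum_eq_single (a := i) (f := fun i => ∑ l, _)] at h
    · have h' := eq_zero_of_sum_tprod_update_eq_zero hlam hinj i
        (fun j => φ (z.2.1 j i)) (fun l => φ (z.2.2 i l)) (by
          rw [← h]
          congr 1
          · refine Finset.sum_congr rfl fun j _ => ?_
            rw [Finset.sum_eq_single (a := i)]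
            · rw [hup _ _ (hπp j), hfi]
            · intro b _ hb
              exact hzero _ (hp₀ j i m hm) b hb _
            · simp
          · refine Finset.sum_congr rfl fun l _ => ?_
            rw [hup _ _ (hπq i l), hfi])
      exact ⟨fun j => by simpa [φ] using congrFun (congrFun h'.1 j) 0,
        fun l => by simpa [φ] using congrFun (congrFun h'.2 l) 0⟩
    · intro b _ hb
      exact Finset.sum_eq_zero fun l _ => hzero _ (hq₀ b l i m hm) b hb _
    · simp
  have hvec (i : Fin k) (v : Fin (n' i + 1) → K) (hv : π i v = 0)
      (hv' : ∀ m : Fin (n' i + 1), n i + 1 ≤ m.val → v m = 0) : v = 0 := by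
    ext m
    by_cases hm : n i + 1 ≤ m.val
    · exact hv' m hm
    · exact congrFun hv ⟨m, not_le.1 hm⟩
  refine Prod.ext (funext hc) (Prod.ext (funext fun j => funext fun i => Subtype.ext ?_)
    (funext fun i => funext fun l => ?_))
  · exact hvec i _ (hx j i) fun m hm => (key i m hm).1 j
  · exact hvec i _ (hy i l) fun m hm => (key i m hm).2 l

theorem exists_extend_by_zero {r r' : ℕ} (h : r ≤ r') (v : Fin r → K) :
    ∃ v' : Fin r' → K, (∀ m, v' (Fin.castLE h m) = v m) ∧ ∀ m, r ≤ m.val → v' m = 0 := by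
  refine ⟨fun m => if hm : m.val < r then v ⟨m, hm⟩ else 0, fun m => by simp, fun m hm => ?_⟩
  simp [hm]

theorem THolds.mono_of_subabundant [NeZero k] (hT : THolds K n s a) (hsub : Subabundant n s a)
    (hn : ∀ i, n i ≤ n' i) : THolds K n' s a ∧ Subabundant n' s a := by
  obtain ⟨p, q, hp, hq, hdim⟩ := hT
  obtain ⟨lam, hlam⟩ := exists_dual_apply_eq_one hp
  rw [min_eq_left hsub] at hdim
  have hinj := (finrank_segreSpan_eq_iff q hlam).1 hdim
  have hn' (i : Fin k) : n i + 1 ≤ n' i + 1 := Nat.succ_le_succ (hn i)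
  choose p' hp' hp₀ using fun j i => exists_extend_by_zero (hn' i) (p j i)
  choose q' hq' hq₀ using fun i l j => exists_extend_by_zero (hn' j) (q i l j)
  have hinj' := injective_segreParamMap_of_section hlam hinj hn' hp' hq' hp₀ hq₀
  have hdim' := (finrank_segreSpan_eq_iff q' fun j i => by
    rw [← hlam j i]
    exact congrArg _ (funext (hp' j i))).2 hinj'
  have hsub' : Subabundant n' s a := by
    rw [Subabundant, ← hdim', ← finrank_piTensorProduct_fin (K := K)]
    exact Submodule.finrank_le _
  refine ⟨⟨p', q', fun j i h => hp j i ?_, fun i l j h => hq i l j ?_, ?_⟩, hsub'⟩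
  · ext m
    simp [← hp', h]
  · ext m
    simp [← hq', h]
  · rw [min_eq_left hsub', ← hdim']

theorem exists_ne_zero_forall_ne_zero_eq {n : Fin k → ℕ} (v : ∀ i, Fin (n i + 1) → K) :
    ∃ u : ∀ i, Fin (n i + 1) → K, (∀ i, u i ≠ 0) ∧ ∀ i, v i ≠ 0 → u i = v i := by
  classical
  refine ⟨fun i => if v i = 0 then 1 else v i, fun i => ?_, fun i hi => if_neg hi⟩
  dsimp only
  split_ifs with h
  · exact one_ne_zero
  · exact h

theorem tprod_update_mem_segreG_of_ne_zero_eq {u v : ∀ i, Fin (n i + 1) → K}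
    (huv : ∀ i, v i ≠ 0 → u i = v i) (i : Fin k) (x : Fin (n i + 1) → K) :
    tprod K (update v i x) ∈ segreG K n u i := by
  by_cases h : ∃ j, j ≠ i ∧ v j = 0
  · obtain ⟨j, hj, hv⟩ := h
    rw [MultilinearMap.map_coord_zero _ j (by simp [hj, hv])]
    exact zero_mem _
  · push Not at h
    convert tprod_update_mem_segreG u i x using 2
    ext1 j
    rcases eq_or_ne j i with rfl | hj
    · simp
    · simp [hj, huv j (h j hj)]

theorem THolds.anti_of_superabundant [NeZero k] (hT : THolds K n s a)
    (hsup : Superabundant n s a) (hn : ∀ i, n' i ≤ n i) :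
    THolds K n' s a ∧ Superabundant n' s a := by
  obtain ⟨p, q, -, -, hdim⟩ := hT
  rw [min_eq_right hsup, ← finrank_piTensorProduct_fin (K := K)] at hdim
  have htop : segreSpan p q = ⊤ := Submodule.eq_top_of_finrank_eq hdim
  let π (i : Fin k) : (Fin (n i + 1) → K) →ₗ[K] (Fin (n' i + 1) → K) :=
    LinearMap.funLeft K K (Fin.castLE (Nat.succ_le_succ (hn i)))
  choose p' hp' hpp using fun j => exists_ne_zero_forall_ne_zero_eq fun i => π i (p j i)
  choose q' hq' hqq using fun i l => exists_ne_zero_forall_ne_zero_eq fun j => π j (q i l j)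
  have htop' : segreSpan p' q' = ⊤ := by
    have hle : segreSpan p q ≤ (segreSpan p' q').comap (PiTensorProduct.map π) := by
      refine segreSpan_le (fun j i x => ?_) (fun i l x => ?_) <;>
        rw [Submodule.mem_comap, map_tprod_update]
      · exact segreG_le_segreSpan_left p' q' j i
          (tprod_update_mem_segreG_of_ne_zero_eq (hpp j) i _)
      · exact segreG_le_segreSpan_right p' q' i l
          (tprod_update_mem_segreG_of_ne_zero_eq (hqq i l) i _)
    rw [eq_top_iff, ← span_tprod_eq_top, Submodule.span_le]
    rintro _ ⟨v, rfl⟩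
    choose u hu _ using fun i => exists_extend_by_zero (Nat.succ_le_succ (hn i)) (v i)
    have huv : PiTensorProduct.map π (tprod K u) = tprod K v := by
      rw [map_tprod]
      exact congrArg _ (funext fun i => funext (hu i))
    rw [← huv]
    exact hle (htop ▸ Submodule.mem_top)
  have hdim' : Module.finrank K (segreSpan p' q') = ∏ i, (n' i + 1) := by
    rw [htop', finrank_top, finrank_piTensorProduct_fin]
  have hsup' : Superabundant n' s a := by
    rw [Superabundant, ← hdim']
    exact finrank_segreSpan_le q' hp'
  exact ⟨⟨p', q', hp', hq', by rw [min_eq_right hsup', ← hdim']⟩, hsup'⟩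

end SegreParametrization

/-- Strassen monotonicity.
(i) If `T(n; s; a)` holds and is subabundant and `n' ≥ n` componentwise, then
`T(n'; s; a)` holds and is subabundant.
(ii) If `T(n; s; a)` holds and is superabundant and `n' ≤ n` componentwise, then
`T(n'; s; a)` holds and is superabundant. -/
theorem strassen_monotonicity
    (K : Type*) [Field K] [CharZero K] {k : ℕ}
    (n n' : Fin k → ℕ) (s : ℕ) (a : Fin k → ℕ) :
    (THolds K n s a → Subabundant n s a → (∀ i, n i ≤ n' i) →
      THolds K n' s a ∧ Subabundant n' s a) ∧
    (THolds K n s a → Superabundant n s a → (∀ i, n' i ≤ n i) →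
      THolds K n' s a ∧ Superabundant n' s a) := by
  rcases Nat.eq_zero_or_pos k with rfl | hk
  · obtain rfl : n = n' := Subsingleton.elim _ _
    exact ⟨fun h h' _ => ⟨h, h'⟩, fun h h' _ => ⟨h, h'⟩⟩
  · have : NeZero k := ⟨hk.ne'⟩
    exact ⟨THolds.mono_of_subabundant, THolds.anti_of_superabundant⟩
end

section
/- Let 1 ≤ n₁ ≤ ⋯ ≤ n_k be balanced, i.e. n_k ≤ Π_{i=1}^{k-1}(n_i + 1) − Σ_{i=1}^{k-1} n_i. If s ≤ n_k, then T(n₁,…,n_k; s; 0,…,0) holds and is subabundant; that is, s(1 + Σ_i n_i) ≤ Π_i (n_i + 1) and there exist s points p₁,…,p_s with dim(Σ_{j=1}^s T_{p_j}) = s(1 + Σ_i n_i). -/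
open scoped TensorProduct

/-- The coordinates `∏ᵢ vᵢ(mᵢ)` of the pure tensor `⊗ᵢ vᵢ` in the standard basis. -/
def segreCoord {R ι : Type*} [CommRing R] [Fintype ι] {n : ι → ℕ}
    (v : ∀ i, Fin (n i + 1) → R) (m : ∀ i, Fin (n i + 1)) : R :=
  ∏ i, v i (m i)

theorem map_segreCoord {R S ι : Type*} [CommRing R] [CommRing S] [Fintype ι] {n : ι → ℕ}
    (f : R →+* S) (v : ∀ i, Fin (n i + 1) → R) (m : ∀ i, Fin (n i + 1)) :
    f (segreCoord v m) = segreCoord (fun i c => f (v i c)) m := by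
  simp [segreCoord]

theorem segreCoord_single {R ι : Type*} [CommRing R] [Fintype ι] [DecidableEq ι] {n : ι → ℕ}
    (l m : ∀ i, Fin (n i + 1)) :
    segreCoord (fun i => (Pi.single (l i) 1 : Fin (n i + 1) → R)) m = if m = l then 1 else 0 := by
  simp only [segreCoord, Pi.single_apply, Finset.prod_ite_zero, Finset.prod_const_one]
  simp [funext_iff]

theorem segreCoord_snoc {R : Type*} [CommRing R] {k : ℕ} {n : Fin (k + 1) → ℕ}
    (v : ∀ i : Fin k, Fin (n i.castSucc + 1) → R) (w : Fin (n (Fin.last k) + 1) → R)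
    (m : ∀ i : Fin k, Fin (n i.castSucc + 1)) (b : Fin (n (Fin.last k) + 1)) :
    segreCoord (n := n) (Fin.snoc (α := fun i => Fin (n i + 1) → R) v w)
      (Fin.snoc (α := fun i => Fin (n i + 1)) m b) = segreCoord v m * w b := by
  simp [segreCoord, Fin.prod_univ_castSucc]

/-- The points of the Segre variety `v` with one factor replaced by a basis vector other than
the first one; together with `v` these span the tangent space at `v` if all `v i 0 ≠ 0`. -/
def segreShift {R ι : Type*} [CommRing R] [DecidableEq ι] {n : ι → ℕ}
    (v : ∀ i, Fin (n i + 1) → R) (a : Σ i, Fin (n i)) : ∀ i, Fin (n i + 1) → R :=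
  Function.update v a.1 (Pi.single a.2.succ 1)

/-- The points `x j'` of a family together with the tangent directions at `x j`. -/
def pointsAndShifts {R ι J : Type*} [CommRing R] [DecidableEq ι] {n : ι → ℕ}
    (x : J → ∀ i, Fin (n i + 1) → R) (j : J) :
    J ⊕ (Σ i, Fin (n i)) → ∀ i, Fin (n i + 1) → R :=
  Sum.elim x (segreShift (x j))

theorem map_pointsAndShifts {R S ι J : Type*} [CommRing R] [CommRing S] [DecidableEq ι]
    {n : ι → ℕ} (f : R →+* S) (x : J → ∀ i, Fin (n i + 1) → R) (j : J)
    (a : J ⊕ (Σ i, Fin (n i))) (i : ι) (c : Fin (n i + 1)) :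
    f (pointsAndShifts x j a i c) = pointsAndShifts (fun j i c => f (x j i c)) j a i c := by
  rcases a with a | a
  · rfl
  · simp only [pointsAndShifts, Sum.elim_inr, segreShift]
    by_cases h : i = a.1
    · subst h
      simp [Pi.single_apply, apply_ite f]
    · simp [h]

/-- An injection of `J ⊕ Σ i, Fin (n i)` into the multi-indices sending `j` to `0` and `⟨i, a⟩` to
the multi-index with only nonzero entry `a + 1` at `i`. -/
theorem exists_injective_multiIndex {ι J : Type*} [Fintype ι] [DecidableEq ι] [Fintype J]
    (n : ι → ℕ) (hcard : Fintype.card J + ∑ i, n i ≤ ∏ i, (n i + 1)) (j : J) :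
    ∃ φ : J ⊕ (Σ i, Fin (n i)) → ∀ i, Fin (n i + 1), Function.Injective φ ∧
      φ (Sum.inl j) = 0 ∧
      ∀ a : Σ i, Fin (n i), φ (Sum.inr a) =
        Function.update (0 : ∀ i, Fin (n i + 1)) a.1 a.2.succ := by
  classical
  let u : Option (Σ i, Fin (n i)) → ∀ i, Fin (n i + 1) :=
    fun | none => 0 | some a => Function.update 0 a.1 a.2.succ
  have hu : Function.Injective u := by
    rintro (_ | ⟨i, a⟩) (_ | ⟨i', a'⟩) h
    · rfl
    · exact absurd (congrFun h i') (by simp [u, (Fin.succ_ne_zero _).symm])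
    · exact absurd (congrFun h i) (by simp [u, Fin.succ_ne_zero])
    · have h1 := congrFun h i
      by_cases hi : i = i'
      · subst hi
        simpa [u] using h1
      · simp [u, hi, Fin.succ_ne_zero] at h1
  have hc : Fintype.card {j' // j' ≠ j} ≤ Fintype.card {m // m ∉ Set.range u} := by
    have h1 : Fintype.card {m // m ∉ Set.range u} = _ := Fintype.card_subtype_compl (· ∈ Set.range u)
    have h2 : Fintype.card {m // m ∈ Set.range u} = Fintype.card (Option (Σ i, Fin (n i))) :=
      Set.card_range_of_injective hu
    have h3 : Fintype.card {j' // j' ≠ j} = _ := Fintype.card_subtype_compl (· = j)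
    rw [h1, h2, h3]
    simp
    omega
  obtain ⟨e⟩ := Function.Embedding.nonempty_of_card_le hc
  refine ⟨Sum.elim (fun j' => if h : j' = j then 0 else (e ⟨j', h⟩ : _)) (fun a => u (some a)),
    ?_, by simp, fun a => rfl⟩
  have he : ∀ x o, (e x : ∀ i, Fin (n i + 1)) ≠ u o := fun x o h => (e x).2 ⟨o, h.symm⟩
  refine Function.Injective.sumElim ?_ (fun a b h => Option.some_injective _ (hu h)) ?_
  · intro a b h
    by_cases ha : a = j <;> by_cases hb : b = j
    · rw [ha, hb]
    · simp only [ha, hb, dite_true, dite_false] at h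
      exact absurd h.symm (he _ none)
    · simp only [ha, hb, dite_true, dite_false] at h
      exact absurd h (he _ none)
    · simp only [ha, hb, dite_false] at h
      simpa using e.injective (Subtype.ext h)
  · intro a b
    by_cases ha : a = j
    · simp only [ha, dite_true]
      exact fun h => Option.some_ne_none b (hu (a₁ := none) (a₂ := some b) h).symm
    · simp only [ha, dite_false]
      exact he ⟨a, ha⟩ (some b)

theorem exists_forall_linearIndependent_pointsAndShifts {K ι J : Type*} [Field K] [Infinite K]
    [Fintype ι] [DecidableEq ι] [Fintype J] (n : ι → ℕ)
    (hcard : Fintype.card J + ∑ i, n i ≤ ∏ i, (n i + 1)) :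
    ∃ x : J → ∀ i, Fin (n i + 1) → K, (∀ j i, x j i 0 ≠ 0) ∧
      ∀ j, LinearIndependent K (fun a => segreCoord (pointsAndShifts x j a)) := by
  classical
  choose φ hφ h0 hs using exists_injective_multiIndex n hcard
  let X : J → ∀ i, Fin (n i + 1) → MvPolynomial (J × Σ i, Fin (n i + 1)) K :=
    fun j i c => MvPolynomial.X (j, ⟨i, c⟩)
  let N (t : J × (Σ i, Fin (n i + 1)) → K) (j : J) :
      Matrix (J ⊕ (Σ i, Fin (n i))) (J ⊕ (Σ i, Fin (n i))) K :=
    .of fun a b => segreCoord (pointsAndShifts (fun j i c => t (j, ⟨i, c⟩)) j a) (φ j b)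
  let M (j : J) : Matrix (J ⊕ (Σ i, Fin (n i))) (J ⊕ (Σ i, Fin (n i)))
      (MvPolynomial (J × Σ i, Fin (n i + 1)) K) :=
    .of fun a b => segreCoord (pointsAndShifts X j a) (φ j b)
  have hM (t : J × (Σ i, Fin (n i + 1)) → K) (j : J) :
      MvPolynomial.eval t (M j).det = (N t j).det := by
    rw [RingHom.map_det]
    congr 1
    ext a b
    simp only [M, N, RingHom.mapMatrix_apply, Matrix.map_apply, Matrix.of_apply, map_segreCoord,
      map_pointsAndShifts]
    simp [X]
  have hdet (j : J) : (M j).det ≠ 0 := by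
    intro h
    have h1 := hM (fun y => if y.2.2 = φ j (Sum.inl y.1) y.2.1 then 1 else 0) j
    rw [h, map_zero] at h1
    refine one_ne_zero (α := K) ((Matrix.det_one (n := J ⊕ (Σ i, Fin (n i)))).symm.trans
      ((congrArg Matrix.det ?_).trans h1.symm))
    ext a b
    have key : pointsAndShifts (fun (j' : J) (i : ι) (c : Fin (n i + 1)) =>
        if c = φ j (Sum.inl j') i then (1 : K) else 0) j a =
        fun i => Pi.single (φ j a i) 1 := by
      rcases a with a | a
      · ext i c
        simp [pointsAndShifts, Pi.single_apply]
      · ext i c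
        simp only [pointsAndShifts, Sum.elim_inr, segreShift, hs]
        by_cases hi : i = a.1
        · subst hi
          simp
        · simp [hi, h0, Pi.single_apply]
    simp only [N, Matrix.of_apply, key, segreCoord_single, Matrix.one_apply, (hφ j).eq_iff]
    simp [eq_comm]
  have hP : (∏ j, (M j).det) * ∏ j, ∏ i, X j i 0 ≠ 0 :=
    mul_ne_zero (Finset.prod_ne_zero_iff.2 fun j _ => hdet j)
      (Finset.prod_ne_zero_iff.2 fun j _ => Finset.prod_ne_zero_iff.2 fun i _ =>
        MvPolynomial.X_ne_zero _)
  obtain ⟨t, ht⟩ : ∃ t, MvPolynomial.eval t ((∏ j, (M j).det) * ∏ j, ∏ i, X j i 0) ≠ 0 := by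
    by_contra! h
    exact hP (MvPolynomial.funext fun t => by rw [h t, map_zero])
  simp only [map_mul, map_prod, hM, mul_ne_zero_iff, Finset.prod_ne_zero_iff, Finset.mem_univ,
    true_imp_iff, X, MvPolynomial.eval_X] at ht
  refine ⟨fun j i c => t (j, ⟨i, c⟩), ht.2, fun j => ?_⟩
  refine LinearIndependent.of_comp (LinearMap.funLeft K K (φ j)) ?_
  exact Matrix.linearIndependent_rows_of_det_ne_zero (ht.1 j)

theorem linearIndependent_segreCoord_snoc {K : Type*} [Field K] {k s : ℕ} (n : Fin (k + 1) → ℕ)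
    (x : Fin s → ∀ i : Fin k, Fin (n i.castSucc + 1) → K)
    (hx : ∀ j, LinearIndependent K (fun a => segreCoord (pointsAndShifts x j a)))
    (e : Fin s → Fin (n (Fin.last k))) (he : Function.Injective e)
    (p : Fin s → ∀ i, Fin (n i + 1) → K)
    (hp : ∀ j, p j = Fin.snoc (α := fun i => Fin (n i + 1) → K) (x j)
      (Pi.single 0 1 + Pi.single (e j).succ 1)) :
    LinearIndependent K (fun a : Fin s × Option (Σ i, Fin (n i)) =>
      segreCoord (a.2.elim (p a.1) (segreShift (p a.1)))) := by
  classical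
  rw [Fintype.linearIndependent_iff]
  intro g hg
  have hlast (j : Fin s) (c : Fin (n (Fin.last k))) : segreShift (p j) ⟨Fin.last k, c⟩ =
      Fin.snoc (α := fun i => Fin (n i + 1) → K) (x j) (Pi.single c.succ 1) := by
    rw [segreShift, hp]
    exact Fin.update_snoc_last ..
  have hcast (j : Fin s) (i : Fin k) (c : Fin (n i.castSucc)) :
      segreShift (p j) ⟨i.castSucc, c⟩ =
      Fin.snoc (α := fun i => Fin (n i + 1) → K)
        (segreShift (n := fun i : Fin k => n i.castSucc) (x j) ⟨i, c⟩)
        (Pi.single 0 1 + Pi.single (e j).succ 1) := by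
    rw [segreShift, hp]
    exact (Fin.snoc_update ..).symm
  have hslice (m : ∀ i : Fin k, Fin (n i.castSucc + 1)) (b : Fin (n (Fin.last k) + 1)) :
      ∑ j, ((g (j, none) * segreCoord (x j) m + ∑ a : Σ i : Fin k, Fin (n i.castSucc),
          g (j, some ⟨a.1.castSucc, a.2⟩) * segreCoord (segreShift (x j) a) m) *
          (Pi.single 0 1 + Pi.single (e j).succ 1 : Fin (n (Fin.last k) + 1) → K) b +
        ∑ c, g (j, some ⟨Fin.last k, c⟩) * segreCoord (x j) m *
          (Pi.single c.succ 1 : Fin (n (Fin.last k) + 1) → K) b) = 0 := by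
    have := congrFun hg (Fin.snoc (α := fun i => Fin (n i + 1)) m b)
    simp only [Fintype.sum_prod_type, Fintype.sum_option, Fintype.sum_sigma,
      Fin.sum_univ_castSucc (n := k), Option.elim, hlast, hcast] at this
    simp only [hp, Pi.add_apply, Finset.sum_apply, Pi.smul_apply, smul_eq_mul,
      segreCoord_snoc, Pi.zero_apply] at this
    rw [← this]
    refine Finset.sum_congr rfl fun j _ => ?_
    simp only [Fintype.sum_sigma, add_mul, Finset.sum_mul, mul_assoc, Pi.add_apply, add_assoc]
  have hsucc (m : ∀ i : Fin k, Fin (n i.castSucc + 1)) (c : Fin (n (Fin.last k))) :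
      ∑ j, ((g (j, none) * segreCoord (x j) m + ∑ a : Σ i : Fin k, Fin (n i.castSucc),
          g (j, some ⟨a.1.castSucc, a.2⟩) * segreCoord (segreShift (x j) a) m) *
          (if c = e j then 1 else 0) +
        g (j, some ⟨Fin.last k, c⟩) * segreCoord (x j) m) = 0 := by
    refine Eq.trans ?_ (hslice m c.succ)
    simp [Pi.single_apply]
  have hpts (f : Fin s → K) (hf : ∀ m, ∑ j, f j * segreCoord (x j) m = 0) (j : Fin s) :
      f j = 0 := by
    have := (hx j).comp _ Sum.inl_injective
    rw [Fintype.linearIndependent_iff] at this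
    refine this f (funext fun m => ?_) j
    simpa [pointsAndShifts] using hf m
  have hshift (j : Fin s) (a : Σ i : Fin k, Fin (n i.castSucc)) :
      g (j, some ⟨a.1.castSucc, a.2⟩) = 0 := by
    have := hx j
    rw [Fintype.linearIndependent_iff] at this
    refine this (Sum.elim
      (fun j' => (if j = j' then g (j, none) else 0) + g (j', some ⟨Fin.last k, e j⟩))
      (fun a => g (j, some ⟨a.1.castSucc, a.2⟩))) (funext fun m => ?_) (Sum.inr a)
    have h := hsucc m (e j)
    simp only [he.eq_iff, mul_ite, mul_one, mul_zero, Finset.sum_add_distrib, Finset.sum_ite_eq,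
      Finset.mem_univ, if_true] at h
    simp only [Fintype.sum_sum_type, Sum.elim_inl, Sum.elim_inr, pointsAndShifts,
      Finset.sum_apply, Pi.smul_apply, smul_eq_mul, add_mul, ite_mul, zero_mul,
      Finset.sum_add_distrib, Finset.sum_ite_eq, Finset.mem_univ, if_true, Pi.zero_apply]
    rw [← h]
    ring
  have hnone (j : Fin s) : g (j, none) = 0 := by
    refine hpts (fun j => g (j, none)) (fun m => ?_) j
    refine Eq.trans ?_ (hslice m 0)
    simp [hshift, (Fin.succ_ne_zero _).symm]
  have hlast0 (j : Fin s) (c : Fin (n (Fin.last k))) : g (j, some ⟨Fin.last k, c⟩) = 0 := by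
    refine hpts (fun j => g (j, some ⟨Fin.last k, c⟩)) (fun m => ?_) j
    refine Eq.trans ?_ (hsucc m c)
    simp [hshift, hnone]
  rintro ⟨j, _ | ⟨i, c⟩⟩
  · exact hnone j
  · induction i using Fin.lastCases with
    | last => exact hlast0 j c
    | cast i => exact hshift j ⟨i, c⟩

theorem LinearIndependent.tprod_of_segreCoord {K ι : Type*} [Field K] {k : ℕ} {n : Fin k → ℕ}
    {v : ι → ∀ i, Fin (n i + 1) → K} (h : LinearIndependent K (fun a => segreCoord (v a))) :
    LinearIndependent K (fun a => PiTensorProduct.tprod K (v a)) := by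
  let f : (⨂[K] i, (Fin (n i + 1) → K)) →ₗ[K] ((∀ i, Fin (n i + 1)) → K) :=
    PiTensorProduct.lift (MultilinearMap.pi fun m =>
      (MultilinearMap.mkPiAlgebra K (Fin k) K).compLinearMap fun i => LinearMap.proj (m i))
  have hf : (f ∘ fun a => PiTensorProduct.tprod K (v a)) = fun a => segreCoord (v a) := by
    ext a m
    simp [f, segreCoord]
  exact LinearIndependent.of_comp f (hf ▸ h)

theorem segreTangent_eq_span {K : Type*} [Field K] {k : ℕ} (hk : 1 ≤ k) {n : Fin k → ℕ}
    {v : ∀ i, Fin (n i + 1) → K} (hv : ∀ i, v i 0 ≠ 0) :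
    segreTangent K n v = Submodule.span K (Set.range fun o : Option (Σ i, Fin (n i)) =>
      PiTensorProduct.tprod K (o.elim v (segreShift v))) := by
  apply le_antisymm
  · refine iSup_le fun i => ?_
    rintro _ ⟨w, rfl⟩
    have hw : w = (w 0 / v i 0) • v i + ∑ c : Fin (n i),
        (w c.succ - w 0 / v i 0 * v i c.succ) • Pi.single c.succ (1 : K) := by
      ext c
      induction c using Fin.cases with
      | zero => simp [Finset.sum_apply, hv i, (Fin.succ_ne_zero _).symm]
      | succ c => simp [Finset.sum_apply, Pi.single_apply]
    rw [hw, map_add, map_sum, map_smul]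
    refine add_mem (Submodule.smul_mem _ _ ?_) (sum_mem fun c _ => ?_)
    · exact Submodule.subset_span ⟨none, by simp⟩
    · rw [map_smul]
      exact Submodule.smul_mem _ _ (Submodule.subset_span ⟨some ⟨i, c⟩, rfl⟩)
  · rw [Submodule.span_le]
    rintro _ ⟨_ | ⟨i, c⟩, rfl⟩
    · exact Submodule.mem_iSup_of_mem ⟨0, hk⟩ ⟨v _, by simp⟩
    · exact Submodule.mem_iSup_of_mem i ⟨Pi.single c.succ 1, rfl⟩

/-- Let `1 ≤ n₁ ≤ ⋯ ≤ n_k` be balanced, i.e.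
`n_k + Σ_{i<k-1} nᵢ ≤ Π_{i<k-1}(nᵢ+1)` (a subtraction-free form of
`n_k ≤ Π_{i<k-1}(nᵢ+1) − Σ_{i<k-1} nᵢ`).  If `s ≤ n_k` then `T(n; s; 0,…,0)` holds
and is subabundant: `s(1 + Σᵢ nᵢ) ≤ Πᵢ(nᵢ+1)` and there exist `s` points whose tangent
spaces span a subspace of dimension `s(1 + Σᵢ nᵢ)`. -/
theorem balanced_THolds_of_le
    (K : Type*) [Field K] [CharZero K] {k : ℕ} (hk : 1 ≤ k)
    (n : Fin k → ℕ) (hmono : Monotone n) (hpos : ∀ i, 1 ≤ n i)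
    (hbal : n ⟨k - 1, by omega⟩
          + ∑ i ∈ Finset.univ.filter (fun i : Fin k => (i : ℕ) + 1 < k), n i
        ≤ ∏ i ∈ Finset.univ.filter (fun i : Fin k => (i : ℕ) + 1 < k), (n i + 1))
    (s : ℕ) (hs : s ≤ n ⟨k - 1, by omega⟩) :
    s * (1 + ∑ i, n i) ≤ ∏ i, (n i + 1) ∧
    ∃ p : Fin s → ∀ i, Fin (n i + 1) → K,
      (∀ j i, p j i ≠ 0) ∧
      Module.finrank K
        ((⨆ j, segreTangent K n (p j)) : Submodule K (⨂[K] i, (Fin (n i + 1) → K)))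
        = s * (1 + ∑ i, n i) := by
  obtain ⟨k, rfl⟩ : ∃ m, k = m + 1 := ⟨k - 1, by omega⟩
  replace hs : s ≤ n (Fin.last k) := hs
  replace hbal : n (Fin.last k) + ∑ i : Fin k, n i.castSucc ≤ ∏ i : Fin k, (n i.castSucc + 1) := by
    simpa [Finset.sum_filter, Finset.prod_filter, Fin.sum_univ_castSucc,
      Fin.prod_univ_castSucc, Fin.last] using hbal
  refine ⟨?_, ?_⟩
  · rw [Fin.sum_univ_castSucc, Fin.prod_univ_castSucc]
    calc s * (1 + (∑ i : Fin k, n i.castSucc + n (Fin.last k)))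
        ≤ n (Fin.last k) * (1 + ∏ i : Fin k, (n i.castSucc + 1)) :=
          Nat.mul_le_mul hs (by omega)
      _ ≤ (∏ i : Fin k, (n i.castSucc + 1)) * (n (Fin.last k) + 1) := by
          have : n (Fin.last k) ≤ ∏ i : Fin k, (n i.castSucc + 1) := by omega
          linarith
  obtain ⟨x, hx0, hx⟩ := exists_forall_linearIndependent_pointsAndShifts (K := K) (J := Fin s)
    (fun i : Fin k => n i.castSucc) (by rw [Fintype.card_fin]; omega)
  let p : Fin s → ∀ i, Fin (n i + 1) → K := fun j =>
    Fin.snoc (α := fun i => Fin (n i + 1) → K) (x j)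
      (Pi.single 0 1 + Pi.single (Fin.castLE hs j).succ 1)
  have hp0 : ∀ j i, p j i 0 ≠ 0 := by
    intro j i
    induction i using Fin.lastCases with
    | last => simp [p, (Fin.succ_ne_zero _).symm]
    | cast i => simpa [p] using hx0 j i
  have hli := (linearIndependent_segreCoord_snoc n x hx (Fin.castLE hs)
    (Fin.castLE_injective hs) p fun _ => rfl).tprod_of_segreCoord
  refine ⟨p, fun j i h => hp0 j i (by rw [h]; rfl), ?_⟩
  have hspan : (⨆ j, segreTangent K n (p j)) = Submodule.span K (Set.range
      fun a : Fin s × Option (Σ i, Fin (n i)) =>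
        PiTensorProduct.tprod K (a.2.elim (p a.1) (segreShift (p a.1)))) := by
    simp only [segreTangent_eq_span hk (hp0 _), ← Submodule.span_iUnion]
    congr 1
    ext
    simp
  rw [hspan, finrank_span_eq_card hli]
  simp [add_comm]
end
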